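/- arXiv:2211.07020 — 3 statements merged into one kernel-verified Lean document; each statement's English description precedes it below -/
import Mathlib

section
/- For every field K, every integer n ≥ 2 and every simple graph G on the vertex set [n], the ideal I_{n-1}(X_G) ⊆ R of submaximal minors of the sparse generic symmetric matrix X_G is a radical ideal. -/
open MvPolynomial
open scoped Classical

/-- The polynomial ring `R = K[x_{ij} : 1 ≤ i ≤ j ≤ n]`, realized as the multivariate
polynomial ring whose variables are indexed by unordered pairs of elements of `Fin n`
(so that `x_{ij} = x_{ji}` automatically). -/
abbrev SymPolyRing (K : Type*) [Field K] (n : ℕ) := MvPolynomial (Sym2 (Fin n)) K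


/-- The sparse generic symmetric `n × n` matrix `X_G` associated to a simple graph `G`
on `[n]`: its `(i,j)` entry is the variable `x_{ij}` if `i = j` or `ij` is an edge of `G`,
and `0` otherwise (i.e. all variables in `Z` are replaced by `0`). -/
noncomputable def sparseGenericSym (K : Type*) [Field K] (n : ℕ) (G : SimpleGraph (Fin n)) :
    Matrix (Fin n) (Fin n) (SymPolyRing K n) :=
  fun i j => if i = j ∨ G.Adj i j then MvPolynomial.X s(i, j) else 0


/-- The ideal of `k × k` minors of a square matrix `M` over a commutative ring: it is
generated by the determinants of all `k × k` submatrices of `M` (given by choosing `k`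
distinct rows and `k` distinct columns). -/
noncomputable def minorsIdeal {R : Type*} [CommRing R] {n : ℕ} (k : ℕ)
    (M : Matrix (Fin n) (Fin n) R) : Ideal R :=
  Ideal.span { d | ∃ f g : Fin k → Fin n,
    Function.Injective f ∧ Function.Injective g ∧ d = (M.submatrix f g).det }


lemma pp_fixed_point {F ι : Type*} [Field F] (Φ : (ι → PowerSeries F) → ι → PowerSeries F)
    (hΦ : ∀ (k : ℕ) (η η' : ι → PowerSeries F),
      (∀ i, (PowerSeries.X : PowerSeries F) ^ k ∣ η i - η' i) →
      ∀ i, (PowerSeries.X : PowerSeries F) ^ k ∣ Φ η i - Φ η' i) (y : ι → PowerSeries F) :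
    ∃ η : ι → PowerSeries F, ∀ i, η i = y i + PowerSeries.X * Φ η i := by
  let s : ℕ → ι → PowerSeries F := fun k =>
    Nat.rec y (fun _ η i => y i + PowerSeries.X * Φ η i) k
  have hs : ∀ k i, s (k + 1) i = y i + PowerSeries.X * Φ (s k) i := fun k i => rfl
  have h1 : ∀ k i, (PowerSeries.X : PowerSeries F) ^ (k + 1) ∣ s (k + 1) i - s k i := by
    intro k
    induction k with
    | zero =>
      intro i
      rw [hs]
      exact ⟨Φ (s 0) i, by simp [s]⟩
    | succ k ih =>
      intro i
      rw [hs (k + 1), hs k]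
      obtain ⟨w, hw⟩ := hΦ _ _ _ ih i
      exact ⟨w, by rw [pow_succ']; linear_combination PowerSeries.X * hw⟩
  have h2 : ∀ k l i, (PowerSeries.X : PowerSeries F) ^ (k + 1) ∣ s (k + l) i - s k i := by
    intro k l i
    induction l with
    | zero => simp
    | succ l ih =>
      have := dvd_add ((pow_dvd_pow _ (by omega : k + 1 ≤ k + l + 1)).trans (h1 (k + l) i)) ih
      rw [← add_assoc]
      simpa using this
  let η : ι → PowerSeries F := fun i => PowerSeries.mk fun k => PowerSeries.coeff k (s k i)
  have h3 : ∀ k i, (PowerSeries.X : PowerSeries F) ^ (k + 1) ∣ η i - s k i := by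
    intro k i
    rw [PowerSeries.X_pow_dvd_iff]
    intro m hm
    obtain ⟨l, rfl⟩ := Nat.exists_eq_add_of_le (Nat.lt_succ_iff.mp hm)
    have := (PowerSeries.X_pow_dvd_iff.mp (h2 m l i)) m (Nat.lt_succ_self m)
    simp only [map_sub, η, PowerSeries.coeff_mk] at this ⊢
    rw [← neg_sub, this, neg_zero]
  refine ⟨η, fun i => ?_⟩
  rw [← sub_eq_zero]
  ext k
  have h4 : (PowerSeries.X : PowerSeries F) ^ (k + 1) ∣ η i - (y i + PowerSeries.X * Φ η i) := by
    have ha := h3 (k + 1) i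
    rw [hs] at ha
    obtain ⟨u, hu⟩ := hΦ _ _ _ (h3 k) i
    obtain ⟨v, hv⟩ := ha
    exact ⟨PowerSeries.X * v - PowerSeries.X * u, by
      linear_combination hv - PowerSeries.X * hu⟩
  simpa using (PowerSeries.X_pow_dvd_iff.mp h4) k (Nat.lt_succ_self k)

lemma pp_prod_congr {F ι : Type*} [Field F] (s : Finset ι) (e : ι → ℕ) (k : ℕ)
    (η η' : ι → PowerSeries F)
    (h : ∀ i, (PowerSeries.X : PowerSeries F) ^ k ∣ η i - η' i) :
    (PowerSeries.X : PowerSeries F) ^ k ∣ ∏ i ∈ s, η i ^ e i - ∏ i ∈ s, η' i ^ e i := by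
  rw [← Ideal.mem_span_singleton, ← Ideal.Quotient.eq]
  simp only [map_prod, map_pow]
  refine Finset.prod_congr rfl fun i _ => ?_
  congr 1
  rw [Ideal.Quotient.eq, Ideal.mem_span_singleton]
  exact h i

/-- total cost of an exponent vector -/
def pp_cst {ι : Type*} [Fintype ι] (c : ι → ℕ) (m : ι →₀ ℕ) : ℕ := ∑ i, c i * m i

/-- rescaled point -/
noncomputable def pp_pt {F ι : Type*} [Field F] (c : ι → ℕ) (η : ι → PowerSeries F) :
    ι → PowerSeries F := fun z => PowerSeries.X ^ (c z) * η z

lemma pp_eval {K F ι : Type*} [Field K] [Field F] [Algebra K F] [Fintype ι] (c : ι → ℕ)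
    (p : MvPolynomial ι K) (g : ι →₀ ℕ)
    (hg : ∀ m ∈ p.support, m ≠ g → pp_cst c g < pp_cst c m) :
    ∃ Ψ : (ι → PowerSeries F) → PowerSeries F,
      (∀ (k : ℕ) (η η' : ι → PowerSeries F),
        (∀ i, (PowerSeries.X : PowerSeries F) ^ k ∣ η i - η' i) →
        (PowerSeries.X : PowerSeries F) ^ k ∣ Ψ η - Ψ η') ∧
      ∀ η, aeval (pp_pt c η) p = PowerSeries.X ^ (pp_cst c g) *
        (PowerSeries.C (algebraMap K F (coeff g p)) * ∏ i, η i ^ g i +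
          PowerSeries.X * Ψ η) := by
  refine ⟨fun η => ∑ m ∈ p.support.erase g, PowerSeries.C (algebraMap K F (coeff m p)) *
    (PowerSeries.X ^ (pp_cst c m - pp_cst c g - 1) * ∏ i, η i ^ m i), ?_, ?_⟩
  · intro k η η' h
    dsimp only
    rw [← Finset.sum_sub_distrib]
    refine Finset.dvd_sum fun m _ => ?_
    rw [← mul_sub, ← mul_sub]
    exact ((pp_prod_congr _ _ _ _ _ h).mul_left _).mul_left _
  · intro η
    have key : ∀ m : ι →₀ ℕ, ∏ i, (pp_pt c η i) ^ m i =
        PowerSeries.X ^ (pp_cst c m) * ∏ i, η i ^ m i := by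
      intro m
      simp only [pp_pt, mul_pow, Finset.prod_mul_distrib, ← pow_mul, Finset.prod_pow_eq_pow_sum,
        pp_cst]
    rw [aeval_def, eval₂_eq']
    have hal : ∀ k : K, algebraMap K (PowerSeries F) k = PowerSeries.C (algebraMap K F k) :=
      fun k => by rw [PowerSeries.algebraMap_apply]
    have hsum : ∑ m ∈ p.support, algebraMap K (PowerSeries F) (coeff m p) *
        ∏ i, (pp_pt c η i) ^ m i = algebraMap K (PowerSeries F) (coeff g p) *
        ∏ i, (pp_pt c η i) ^ g i + ∑ m ∈ p.support.erase g,
          algebraMap K (PowerSeries F) (coeff m p) * ∏ i, (pp_pt c η i) ^ m i := by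
      by_cases h : g ∈ p.support
      · exact (Finset.add_sum_erase _ (fun m => algebraMap K (PowerSeries F) (coeff m p) *
          ∏ i, (pp_pt c η i) ^ m i) h).symm
      · rw [Finset.erase_eq_of_notMem h]
        rw [notMem_support_iff.mp h]
        simp
    rw [hsum, mul_add, Finset.mul_sum, Finset.mul_sum]
    congr 1
    · rw [key, hal]; ring
    · refine Finset.sum_congr rfl fun m hm => ?_
      have h1 := hg m (Finset.mem_of_mem_erase hm) (Finset.ne_of_mem_erase hm)
      rw [key, hal]
      have h2 : (PowerSeries.X : PowerSeries F) ^ pp_cst c m = PowerSeries.X ^ pp_cst c g *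
          (PowerSeries.X * PowerSeries.X ^ (pp_cst c m - pp_cst c g - 1)) := by
        rw [← pow_succ', ← pow_add]
        congr 1
        omega
      rw [h2]; ring

lemma pp_eval_ne_zero {K F ι : Type*} [Field K] [Field F] [Algebra K F] [Fintype ι] (c : ι → ℕ)
    (p : MvPolynomial ι K) (g : ι →₀ ℕ)
    (hg : ∀ m ∈ p.support, m ≠ g → pp_cst c g < pp_cst c m) (hp : coeff g p ≠ 0)
    (η : ι → PowerSeries F)
    (hη : ∀ i, g i ≠ 0 → PowerSeries.constantCoeff (η i) ≠ 0) :
    aeval (pp_pt c η) p ≠ 0 := by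
  obtain ⟨Ψ, -, h⟩ := pp_eval (F := F) c p g hg
  rw [h]
  refine mul_ne_zero (pow_ne_zero _ PowerSeries.X_ne_zero) fun h0 => ?_
  have := congrArg PowerSeries.constantCoeff h0
  simp only [map_add, map_mul, PowerSeries.constantCoeff_X, zero_mul, add_zero,
    PowerSeries.constantCoeff_C, map_prod, map_pow, map_zero, mul_eq_zero] at this
  rcases this with h1 | h1
  · exact hp ((map_eq_zero _).mp h1)
  · rw [Finset.prod_eq_zero_iff] at h1
    obtain ⟨i, -, hi⟩ := h1
    have h3 : g i ≠ 0 := by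
      intro h4; rw [h4] at hi; simp at hi
    exact hη i h3 ((pow_eq_zero_iff h3).mp hi)

/-- solve for the variables in `Q` -/
lemma pp_solve {K F ι J : Type*} [Field K] [Field F] [Algebra K F] [Fintype ι] (c : ι → ℕ)
    (p : J → MvPolynomial ι K) (g : J → ι →₀ ℕ)
    (hg : ∀ j, ∀ m ∈ (p j).support, m ≠ g j → pp_cst c (g j) < pp_cst c m)
    (hp : ∀ j, coeff (g j) (p j) ≠ 0)
    (Q : Finset ι) (jq : ι → J) (y : ι → F) (hy : ∀ z, z ∉ Q → y z ≠ 0)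
    (h1 : ∀ q ∈ Q, g (jq q) q = 1) (h2 : ∀ q ∈ Q, ∀ q' ∈ Q, q' ≠ q → g (jq q) q' = 0) :
    ∃ η : ι → PowerSeries F, (∀ z, z ∉ Q → η z = PowerSeries.C (y z)) ∧
      (∀ q ∈ Q, PowerSeries.constantCoeff (η q) = 0) ∧
      ∀ q ∈ Q, aeval (pp_pt c η) (p (jq q)) = 0 := by
  choose Ψ hΨ1 hΨ2 using fun j => pp_eval (F := F) c (p j) (g j) (hg j)
  let U : ι → F := fun q => algebraMap K F (coeff (g (jq q)) (p (jq q))) *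
    ∏ i ∈ Finset.univ.erase q, (y i) ^ (g (jq q) i)
  have hU : ∀ q ∈ Q, U q ≠ 0 := by
    intro q hq
    refine mul_ne_zero (by simpa using hp _) (Finset.prod_ne_zero_iff.mpr fun i hi => ?_)
    by_cases hiQ : i ∈ Q
    · rw [h2 q hq i hiQ (Finset.ne_of_mem_erase hi)]; simp
    · exact pow_ne_zero _ (hy i hiQ)
  obtain ⟨η, hη⟩ := pp_fixed_point (F := F) (ι := ι)
    (fun η q => if q ∈ Q then - PowerSeries.C (U q)⁻¹ * Ψ (jq q) η else 0) (by
      intro k η η' h i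
      by_cases hi : i ∈ Q
      · simp only [hi, if_true]
        rw [← mul_sub]
        exact (hΨ1 _ k η η' h).mul_left _
      · simp [hi]) (fun z => if z ∈ Q then 0 else PowerSeries.C (y z))
  have hη1 : ∀ z, z ∉ Q → η z = PowerSeries.C (y z) := by
    intro z hz
    rw [hη z]; simp [hz]
  refine ⟨η, hη1, ?_, ?_⟩
  · intro q hq
    rw [hη q]; simp [hq]
  · intro q hq
    rw [hΨ2]
    have e1 : ∏ i, η i ^ (g (jq q)) i = η q * ∏ i ∈ Finset.univ.erase q,
        PowerSeries.C ((y i) ^ (g (jq q) i)) := by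
      rw [← Finset.mul_prod_erase _ _ (Finset.mem_univ q), h1 q hq, pow_one]
      congr 1
      refine Finset.prod_congr rfl fun i hi => ?_
      by_cases hiQ : i ∈ Q
      · rw [h2 q hq i hiQ (Finset.ne_of_mem_erase hi)]; simp
      · rw [hη1 i hiQ, map_pow]
    have e2 : PowerSeries.C (algebraMap K F (coeff (g (jq q)) (p (jq q)))) *
        ∏ i, η i ^ (g (jq q)) i = PowerSeries.C (U q) * η q := by
      rw [e1]
      simp only [U, map_mul, map_prod]
      ring
    rw [e2]
    have e3 := hη q
    simp only [hq, if_true, zero_add] at e3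
    have e4 : PowerSeries.C (U q) * PowerSeries.C (U q)⁻¹ = (1 : PowerSeries F) := by
      rw [← map_mul, mul_inv_cancel₀ (hU q hq), map_one]
    have : PowerSeries.C (U q) * η q + PowerSeries.X * Ψ (jq q) η = 0 := by
      linear_combination PowerSeries.C (U q) * e3 - PowerSeries.X * Ψ (jq q) η * e4
    rw [this, mul_zero]

lemma pp_top {K F ι : Type*} [Field K] [Field F] [Algebra K F] [Fintype ι]
    (c w : ι → ℕ) (n : ℕ) (hcw : ∀ z, c z + w z = n) (I : Ideal (MvPolynomial ι K))
    (S : Set (MvPolynomial ι K)) (hI : I = Ideal.span S)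
    (hS : ∀ p ∈ S, ∃ D, ∀ m ∈ p.support, ∑ i, m i = D)
    (η : ι → PowerSeries F) (hη : ∀ p ∈ S, aeval (pp_pt c η) p = 0)
    (f : MvPolynomial ι K) (hf : f ∈ I.radical) (N : ℕ) (hN : ∀ m ∈ f.support, pp_cst w m ≤ N) :
    ∑ m ∈ f.support with pp_cst w m = N, algebraMap K F (coeff m f) *
      ∏ i, (PowerSeries.constantCoeff (η i)) ^ m i = 0 := by
  let L := FractionRing (PowerSeries F)
  let e : L := algebraMap (PowerSeries F) L PowerSeries.X
  have he : e ≠ 0 := by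
    intro h
    exact PowerSeries.X_ne_zero ((map_eq_zero_iff _ (IsFractionRing.injective (PowerSeries F) L)).mp h)
  let φ : ι → L := fun z => (e ^ (w z))⁻¹ * algebraMap (PowerSeries F) L (η z)
  have hφ : ∀ z, φ z * e ^ n = algebraMap (PowerSeries F) L (pp_pt c η z) := by
    intro z
    simp only [φ, pp_pt, map_mul, map_pow]
    rw [← hcw z, pow_add]
    change (e ^ w z)⁻¹ * _ * (e ^ c z * e ^ w z) = e ^ c z * _
    have hw : (e ^ w z)⁻¹ * e ^ w z = 1 := inv_mul_cancel₀ (pow_ne_zero _ he)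
    linear_combination (algebraMap (PowerSeries F) L (η z)) * e ^ c z * hw
  have h0 : ∀ p ∈ S, aeval φ p = 0 := by
    intro p hp
    obtain ⟨D, hD⟩ := hS p hp
    have h1 := congrArg (algebraMap (PowerSeries F) L) (hη p hp)
    have h2 : aeval φ p * e ^ (n * D) = 0 := by
      rw [map_zero] at h1
      rw [← h1, aeval_def, aeval_def, eval₂_eq', eval₂_eq', map_sum, Finset.sum_mul]
      refine Finset.sum_congr rfl fun m hm => ?_
      rw [map_mul, map_prod, mul_assoc, ← hD m hm, Finset.mul_sum, ← Finset.prod_pow_eq_pow_sum,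
        ← Finset.prod_mul_distrib]
      congr 1
      refine Finset.prod_congr rfl fun i _ => ?_
      rw [map_pow, ← hφ i, mul_pow (φ i), ← pow_mul]
    exact (mul_eq_zero.mp h2).resolve_right (pow_ne_zero _ he)
  have hle : I ≤ RingHom.ker (aeval φ : MvPolynomial ι K →ₐ[K] L) := by
    rw [hI, Ideal.span_le]
    intro p hp
    exact h0 p hp
  have hf0 : aeval φ f = 0 := by
    obtain ⟨k, hk⟩ := hf
    have := hle hk
    rw [RingHom.mem_ker, map_pow] at this
    exact eq_zero_of_pow_eq_zero this
  let s : PowerSeries F := ∑ m ∈ f.support, PowerSeries.C (algebraMap K F (coeff m f)) *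
    (PowerSeries.X ^ (N - pp_cst w m) * ∏ i, η i ^ m i)
  have hs : algebraMap (PowerSeries F) L s = e ^ N * aeval φ f := by
    rw [aeval_def, eval₂_eq', map_sum, Finset.mul_sum]
    refine Finset.sum_congr rfl fun m hm => ?_
    have h3 : ∏ i, φ i ^ m i = (e ^ pp_cst w m)⁻¹ *
        algebraMap (PowerSeries F) L (∏ i, η i ^ m i) := by
      simp only [φ, mul_pow, Finset.prod_mul_distrib, map_prod, map_pow, pp_cst,
        ← Finset.prod_pow_eq_pow_sum, pow_mul, Finset.prod_inv_distrib, inv_pow]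
    have h4 : e ^ N = e ^ (N - pp_cst w m) * e ^ pp_cst w m := by
      rw [← pow_add, Nat.sub_add_cancel (hN m hm)]
    have h5 : algebraMap K L (coeff m f) =
        algebraMap (PowerSeries F) L (PowerSeries.C (algebraMap K F (coeff m f))) := by
      rw [IsScalarTower.algebraMap_apply K (PowerSeries F) L, PowerSeries.algebraMap_apply]
    have h6 : (e ^ pp_cst w m)⁻¹ * e ^ pp_cst w m = 1 := inv_mul_cancel₀ (pow_ne_zero _ he)
    rw [h3, h4, h5, map_mul, map_mul, map_pow]
    change _ * (e ^ _ * _) = _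
    linear_combination (- algebraMap (PowerSeries F) L (PowerSeries.C (algebraMap K F (coeff m f)))
      * e ^ (N - pp_cst w m) * algebraMap (PowerSeries F) L (∏ i, η i ^ m i)) * h6
  rw [hf0, mul_zero] at hs
  have hs0 : s = 0 := (map_eq_zero_iff _ (IsFractionRing.injective (PowerSeries F) L)).mp hs
  have hs1 := congrArg PowerSeries.constantCoeff hs0
  rw [map_zero] at hs1
  rw [← hs1, map_sum, Finset.sum_filter]
  refine Finset.sum_congr rfl fun m hm => ?_
  simp only [map_mul, PowerSeries.constantCoeff_C, map_pow, PowerSeries.constantCoeff_X, map_prod]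
  split_ifs with h
  · rw [h]; simp
  · rw [zero_pow (by have := hN m hm; omega)]; simp

/-- The abstract radicality criterion. -/
theorem pp_radical {K : Type*} {ι : Type} {J : Type} [Nonempty J] [Field K] [Fintype ι]
    (c w : ι → ℕ) (n : ℕ) (hcw : ∀ z, c z + w z = n)
    (p : J → MvPolynomial ι K) (g : J → ι →₀ ℕ)
    (hg : ∀ j, ∀ m ∈ (p j).support, m ≠ g j → pp_cst c (g j) < pp_cst c m)
    (hp : ∀ j, coeff (g j) (p j) ≠ 0)
    (D : ℕ) (hD : ∀ j, ∀ m ∈ (p j).support, ∑ i, m i = D)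
    (hQ : ∀ m : ι →₀ ℕ, (∀ j, ¬ g j ≤ m) → ∃ (Q : Finset ι) (jq : ι → J),
      (∀ q ∈ Q, m q = 0) ∧ (∀ q ∈ Q, g (jq q) q = 1) ∧
      (∀ q ∈ Q, ∀ q' ∈ Q, q' ≠ q → g (jq q) q' = 0) ∧
      ∀ η : ι → PowerSeries (FractionRing (MvPolynomial ι K)),
        (∀ z, z ∉ Q → PowerSeries.constantCoeff (η z) ≠ 0) →
        (∀ q ∈ Q, PowerSeries.constantCoeff (η q) = 0) →
        (∀ q ∈ Q, aeval (pp_pt c η) (p (jq q)) = 0) → ∀ j, aeval (pp_pt c η) (p j) = 0) :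
    (Ideal.span (Set.range p)).IsRadical := by
  set I := Ideal.span (Set.range p) with hI
  have hpI : ∀ j, p j ∈ I := fun j => Ideal.subset_span ⟨j, rfl⟩
  -- top monomials of elements of the radical are divisible by some leading monomial
  have key : ∀ f ∈ I.radical, ∀ N, (∀ m ∈ f.support, pp_cst w m ≤ N) →
      ∀ m ∈ f.support, pp_cst w m = N → ∃ j, g j ≤ m := by
    intro f hf N hN m hm hmN
    by_contra hcon
    push Not at hcon
    obtain ⟨Q, jq, hQ0, hQ1, hQ2, hQ3⟩ := hQ m hcon
    let F := FractionRing (MvPolynomial ι K)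
    let y : ι → MvPolynomial ι K := fun z => if z ∈ Q then 0 else MvPolynomial.X z
    have hinj := IsFractionRing.injective (MvPolynomial ι K) F
    obtain ⟨η, h1, h2, h3⟩ := pp_solve (F := F) c p g hg hp Q jq
      (fun z => algebraMap _ F (y z)) (by
        intro z hz
        simp only [y, hz, if_false]
        intro h
        exact MvPolynomial.X_ne_zero z ((map_eq_zero_iff _ hinj).mp h)) hQ1 hQ2
    have hy : ∀ z, PowerSeries.constantCoeff (η z) = algebraMap _ F (y z) := by
      intro z
      by_cases hz : z ∈ Q
      · rw [h2 z hz]; simp [y, hz]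
      · rw [h1 z hz]; simp
    have h4 := hQ3 η (by
      intro z hz
      rw [hy]
      simp only [y, hz, if_false]
      intro h
      exact MvPolynomial.X_ne_zero z ((map_eq_zero_iff _ hinj).mp h)) h2 h3
    have h5 := pp_top c w n hcw I (Set.range p) hI (by
      rintro _ ⟨j, rfl⟩; exact ⟨D, hD j⟩) η (by rintro _ ⟨j, rfl⟩; exact h4 j) f hf N hN
    have h6 : ∑ m ∈ f.support with pp_cst w m = N, MvPolynomial.C (coeff m f) *
        ∏ i, y i ^ m i = 0 := by
      apply hinj
      rw [map_zero, ← h5, map_sum]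
      refine Finset.sum_congr rfl fun m' _ => ?_
      rw [map_mul, map_prod]
      congr 1
      refine Finset.prod_congr rfl fun i _ => ?_
      rw [hy, map_pow]
    have h7 := congrArg (coeff m) h6
    rw [coeff_sum, coeff_zero, Finset.sum_eq_single m] at h7
    · have h8 : ∏ i, y i ^ m i = monomial m 1 := by
        rw [monomial_eq, Finsupp.prod_fintype _ _ (by simp), C_1, one_mul]
        refine Finset.prod_congr rfl fun i _ => ?_
        by_cases hi : i ∈ Q
        · rw [hQ0 i hi]; simp
        · simp [y, hi]
      rw [h8, C_mul_monomial, mul_one, coeff_monomial, if_pos rfl] at h7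
      exact (mem_support_iff.mp hm) h7
    · intro m' _ hne
      by_cases hQm : ∃ q ∈ Q, m' q ≠ 0
      · obtain ⟨q, hq, hq'⟩ := hQm
        rw [Finset.prod_eq_zero (Finset.mem_univ q)]
        · simp
        · simp [y, hq, hq']
      · push Not at hQm
        have h8 : ∏ i, y i ^ m' i = monomial m' 1 := by
          rw [monomial_eq, Finsupp.prod_fintype _ _ (by simp), C_1, one_mul]
          refine Finset.prod_congr rfl fun i _ => ?_
          by_cases hi : i ∈ Q
          · rw [hQm i hi]; simp
          · simp [y, hi]
        rw [h8, C_mul_monomial, mul_one, coeff_monomial, if_neg hne]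
    · intro h
      exact absurd (Finset.mem_filter.mpr ⟨hm, hmN⟩) h
  have hadd : ∀ a b : ι →₀ ℕ, pp_cst w (a + b) = pp_cst w a + pp_cst w b := by
    intro a b
    simp [pp_cst, mul_add, Finset.sum_add_distrib]
  have hcwD : ∀ j, ∀ m ∈ (p j).support, pp_cst c m + pp_cst w m = n * D := by
    intro j m hm
    rw [← hD j m hm, pp_cst, pp_cst, ← Finset.sum_add_distrib, Finset.mul_sum]
    exact Finset.sum_congr rfl fun i _ => by rw [← add_mul, hcw]
  have main : ∀ N, ∀ f ∈ I.radical, (∀ m ∈ f.support, pp_cst w m < N) → f ∈ I := by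
    intro N
    induction N with
    | zero =>
      intro f _ h
      have : f = 0 := by
        rw [← support_eq_empty]
        exact Finset.eq_empty_of_forall_notMem fun m hm => absurd (h m hm) (Nat.not_lt_zero _)
      rw [this]; exact I.zero_mem
    | succ N ih =>
      intro f hf h
      have h1 : ∀ m : ι →₀ ℕ, ∃ j, m ∈ f.support → pp_cst w m = N → g j ≤ m := by
        intro m
        by_cases hm : m ∈ f.support ∧ pp_cst w m = N
        · obtain ⟨j, hj⟩ := key f hf N (fun m hm => Nat.lt_succ_iff.mp (h m hm)) m hm.1 hm.2
          exact ⟨j, fun _ _ => hj⟩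
        · exact ⟨Classical.arbitrary J, fun h1 h2 => absurd ⟨h1, h2⟩ hm⟩
      choose j hj using h1
      let r : MvPolynomial ι K := ∑ m ∈ f.support with pp_cst w m = N,
        monomial (m - g (j m)) (coeff m f / coeff (g (j m)) (p (j m))) * p (j m)
      have hr : r ∈ I := Ideal.sum_mem _ fun m _ => I.mul_mem_left _ (hpI _)
      have h2 : f - r ∈ I := by
        refine ih _ (I.radical.sub_mem hf (Ideal.le_radical hr)) ?_
        intro m hm
        by_contra hlt
        push Not at hlt
        apply mem_support_iff.mp hm
        rw [coeff_sub, sub_eq_zero]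
        -- coefficients of `r` in weight at least `N`
        have h3 : ∀ m' ∈ f.support.filter (fun m => pp_cst w m = N),
            coeff m (monomial (m' - g (j m')) (coeff m' f / coeff (g (j m')) (p (j m'))) *
              p (j m')) = if m = m' then coeff m' f else 0 := by
          intro m' hm'
          obtain ⟨hm1, hm2⟩ := Finset.mem_filter.mp hm'
          have hle := hj m' hm1 hm2
          rw [coeff_monomial_mul']
          split_ifs with ha hb hb
          · subst hb
            rw [tsub_tsub_cancel_of_le hle]
            exact div_mul_cancel₀ _ (hp _)
          · have hne : m - (m' - g (j m')) ≠ g (j m') := by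
              intro he
              apply hb
              have e1 := tsub_add_cancel_of_le ha
              rw [he] at e1
              rw [← e1, add_comm]
              exact tsub_add_cancel_of_le hle
            by_cases hs : m - (m' - g (j m')) ∈ (p (j m')).support
            · exfalso
              have e1 := hg _ _ hs hne
              have e2 := hcwD _ _ hs
              have e3 := hcwD (j m') (g (j m')) (mem_support_iff.mpr (hp _))
              have e4 := hadd (m - (m' - g (j m'))) (m' - g (j m'))
              rw [tsub_add_cancel_of_le ha] at e4
              have e5 := hadd (m' - g (j m')) (g (j m'))
              rw [tsub_add_cancel_of_le hle] at e5
              omega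
            · rw [notMem_support_iff.mp hs, mul_zero]
          · exfalso
            apply ha
            rw [hb]
            exact tsub_le_self
          · rfl
        rw [coeff_sum, Finset.sum_congr rfl h3, Finset.sum_ite_eq]
        split_ifs with hmem
        · rfl
        · by_contra hne
          have hms : m ∈ f.support := mem_support_iff.mpr hne
          have := h m hms
          exact hmem (Finset.mem_filter.mpr ⟨hms, by omega⟩)
      have := I.add_mem h2 hr
      simpa using this
  intro f hf
  exact main ((f.support.sup (pp_cst w)) + 1) f hf
    (fun m hm => Nat.lt_succ_of_le (Finset.le_sup (f := pp_cst w) hm))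

/-! ### Linear algebra -/

lemma pp_det_zero_of_ker {L V : Type*} [Field L] [Fintype V] (M : Matrix V V L) (b c : V)
    (k k' : V → L) (hk : M.mulVec k = 0) (hk' : M.mulVec k' = 0) (hb : k b ≠ 0) (hc : k c = 0)
    (hb' : k' b = 0) (hc' : k' c ≠ 0) (x y : V) :
    (M.updateRow x (Pi.single y 1)).det = 0 := by
  have main : ∀ r : V → L, M.mulVec r = 0 → r y = 0 → r ≠ 0 →
      (M.updateRow x (Pi.single y 1)).det = 0 := by
    intro r h1 h2 h3
    rw [← Matrix.exists_mulVec_eq_zero_iff]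
    refine ⟨r, h3, ?_⟩
    ext i
    by_cases hi : i = x
    · subst hi
      simp [Matrix.mulVec, h2]
    · have := congrFun h1 i
      simpa [Matrix.mulVec, Matrix.updateRow_ne hi] using this
  by_cases h : k y = 0
  · exact main k hk h (fun h => hb (by rw [h]; rfl))
  · refine main (k' y • k - k y • k') ?_ ?_ ?_
    · rw [Matrix.mulVec_sub, Matrix.mulVec_smul, Matrix.mulVec_smul, hk, hk']; simp
    · simp [mul_comm]
    · intro h0
      have := congrFun h0 c
      simp [hc, hc', h] at this

/-- kernel vector extraction -/
lemma pp_ker_of_det {L V : Type*} [Field L] [Fintype V] (M : Matrix V V L) (x y : V)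
    (h : (M.updateRow x (Pi.single y 1)).det = 0) :
    ∃ r : V → L, r ≠ 0 ∧ r y = 0 ∧ ∀ i, i ≠ x → M.mulVec r i = 0 := by
  rw [← Matrix.exists_mulVec_eq_zero_iff] at h
  obtain ⟨r, h1, h2⟩ := h
  refine ⟨r, h1, ?_, ?_⟩
  · have := congrFun h2 x
    simpa [Matrix.mulVec] using this
  · intro i hi
    have := congrFun h2 i
    simpa [Matrix.mulVec, Matrix.updateRow_ne hi] using this

lemma pp_LA1 {L V : Type*} [Field L] [Fintype V] (M : Matrix V V L) (a b : V) (hab : a ≠ b)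
    (hN : ((M.updateRow a (Pi.single a 1)).updateRow b (Pi.single b 1)).det ≠ 0)
    (haa : (M.updateRow a (Pi.single a 1)).det = 0)
    (hbb : (M.updateRow b (Pi.single b 1)).det = 0)
    (h1 : (M.updateRow a (Pi.single b 1)).det = 0)
    (h2 : (M.updateRow b (Pi.single a 1)).det = 0) (x y : V) :
    (M.updateRow x (Pi.single y 1)).det = 0 := by
  set N := (M.updateRow a (Pi.single a 1)).updateRow b (Pi.single b 1) with hNdef
  have hinj : ∀ r : V → L, r a = 0 → r b = 0 → (∀ i, i ≠ a → i ≠ b → M.mulVec r i = 0) → r = 0 := by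
    intro r ha hb hr
    by_contra hne
    apply hN
    rw [← Matrix.exists_mulVec_eq_zero_iff]
    refine ⟨r, hne, ?_⟩
    ext i
    by_cases hi : i = b
    · subst hi; simp [hNdef, Matrix.mulVec, hb]
    · by_cases hi' : i = a
      · subst hi'; simp [hNdef, Matrix.mulVec, ha, Matrix.updateRow_ne hi]
      · have := hr i hi' hi
        simpa [hNdef, Matrix.mulVec, Matrix.updateRow_ne hi, Matrix.updateRow_ne hi'] using this
  -- vector from (a,a),(a,b)
  obtain ⟨r, hr0, hra, hr⟩ := pp_ker_of_det M a a haa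
  obtain ⟨r', hr0', hra', hr'⟩ := pp_ker_of_det M b a h2
  obtain ⟨s, hs0, hsb, hs⟩ := pp_ker_of_det M b b hbb
  obtain ⟨s', hs0', hsb', hs'⟩ := pp_ker_of_det M a b h1
  have hrb : r b ≠ 0 := fun h => hr0 (hinj r hra h fun i h1 _ => hr i h1)
  have hrb' : r' b ≠ 0 := fun h => hr0' (hinj r' hra' h fun i _ h2 => hr' i h2)
  have hsa : s a ≠ 0 := fun h => hs0 (hinj s h hsb fun i _ h2 => hs i h2)
  have hsa' : s' a ≠ 0 := fun h => hs0' (hinj s' h hsb' fun i h1 _ => hs' i h1)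
  have e1 : r' b • r = r b • r' := by
    rw [← sub_eq_zero]
    refine hinj _ (by simp [hra, hra']) (by simp [mul_comm]) fun i h1 h2 => ?_
    rw [Matrix.mulVec_sub, Matrix.mulVec_smul, Matrix.mulVec_smul]
    simp [hr i h1, hr' i h2]
  have e2 : s' a • s = s a • s' := by
    rw [← sub_eq_zero]
    refine hinj _ (by simp [mul_comm]) (by simp [hsb, hsb'])  fun i h1 h2 => ?_
    rw [Matrix.mulVec_sub, Matrix.mulVec_smul, Matrix.mulVec_smul]
    simp [hs i h2, hs' i h1]
  have k1 : M.mulVec r = 0 := by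
    ext i
    by_cases hi : i = a
    · subst hi
      have h3 := congrFun (congrArg M.mulVec e1) i
      rw [Matrix.mulVec_smul, Matrix.mulVec_smul] at h3
      simp only [Pi.smul_apply, smul_eq_mul, hr' i hab, mul_zero, mul_eq_zero] at h3
      exact h3.resolve_left hrb'
    · exact hr i hi
  have k2 : M.mulVec s = 0 := by
    ext i
    by_cases hi : i = b
    · subst hi
      have h3 := congrFun (congrArg M.mulVec e2) i
      rw [Matrix.mulVec_smul, Matrix.mulVec_smul] at h3
      simp only [Pi.smul_apply, smul_eq_mul, hs' i hab.symm, mul_zero, mul_eq_zero] at h3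
      exact h3.resolve_left hsa'
    · exact hs i hi
  exact pp_det_zero_of_ker M b a r s k1 k2 hrb hra hsb hsa x y

lemma pp_LA2 {L V : Type*} [Field L] [Fintype V] (M : Matrix V V L) (a b c : V) (hab : a ≠ b)
    (hac : a ≠ c) (hbc : b ≠ c)
    (hN : (((M.updateRow a (Pi.single a 1)).updateRow b (Pi.single b 1)).updateRow c
      (Pi.single c 1)).det ≠ 0)
    (hA : ((M.updateRow a (Pi.single c 1)).updateRow b (Pi.single b 1)).det ≠ 0)
    (hB : ((M.updateRow a (Pi.single b 1)).updateRow c (Pi.single c 1)).det ≠ 0)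
    (h1 : (M.updateRow a (Pi.single b 1)).det = 0)
    (h2 : (M.updateRow a (Pi.single c 1)).det = 0)
    (h3 : (M.updateRow b (Pi.single c 1)).det = 0)
    (h4 : (M.updateRow c (Pi.single b 1)).det = 0) (x y : V) :
    (M.updateRow x (Pi.single y 1)).det = 0 := by
  set N := ((M.updateRow a (Pi.single a 1)).updateRow b (Pi.single b 1)).updateRow c
      (Pi.single c 1) with hNdef
  have hNa : ∀ r : V → L, N.mulVec r a = r a := by
    intro r; simp [hNdef, Matrix.mulVec, Matrix.updateRow_ne hac, Matrix.updateRow_ne hab]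
  have hNb : ∀ r : V → L, N.mulVec r b = r b := by
    intro r; simp [hNdef, Matrix.mulVec, Matrix.updateRow_ne hbc]
  have hNc : ∀ r : V → L, N.mulVec r c = r c := by
    intro r; simp [hNdef, Matrix.mulVec]
  have hNi : ∀ r : V → L, ∀ i, i ≠ a → i ≠ b → i ≠ c → N.mulVec r i = M.mulVec r i := by
    intro r i ha hb hc
    simp [hNdef, Matrix.mulVec, Matrix.updateRow_ne ha, Matrix.updateRow_ne hb,
      Matrix.updateRow_ne hc]
  have hu : IsUnit N.det := isUnit_iff_ne_zero.mpr hN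
  have hp : ∀ z : V, N.mulVec (N⁻¹.mulVec (Pi.single z 1)) = Pi.single z 1 := by
    intro z
    rw [Matrix.mulVec_mulVec, Matrix.mul_nonsing_inv _ hu, Matrix.one_mulVec]
  let p : V → V → L := fun z => N⁻¹.mulVec (Pi.single z 1)
  have hpa : ∀ z, p z a = (Pi.single z 1 : V → L) a := fun z => by rw [← hp z, hNa]
  have hpb : ∀ z, p z b = (Pi.single z 1 : V → L) b := fun z => by rw [← hp z, hNb]
  have hpc : ∀ z, p z c = (Pi.single z 1 : V → L) c := fun z => by rw [← hp z, hNc]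
  have hpi : ∀ z i, i ≠ a → i ≠ b → i ≠ c → i ≠ z → M.mulVec (p z) i = 0 := fun z i ha hb hc hz => by
    rw [← hNi _ i ha hb hc, hp z]; simp [hz]
  have hinj : ∀ r : V → L, r a = 0 → r b = 0 → r c = 0 →
      (∀ i, i ≠ a → i ≠ b → i ≠ c → M.mulVec r i = 0) → r = 0 := by
    intro r ha hb hc hr
    have : N.mulVec r = 0 := by
      ext i
      by_cases h : i = a
      · rw [h, hNa, ha]; rfl
      by_cases h' : i = b
      · rw [h', hNb, hb]; rfl
      by_cases h'' : i = c
      · rw [h'', hNc, hc]; rfl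
      rw [hNi r i h h' h'', hr i h h' h'']; rfl
    by_contra hne
    exact hN (Matrix.exists_mulVec_eq_zero_iff.mp ⟨r, hne, this⟩)
  have pab : p a b = 0 := by rw [hpb]; simp [hab.symm]
  have paa : p a a = 1 := by rw [hpa]; simp
  have pac : p a c = 0 := by rw [hpc]; simp [hac.symm]
  have pba : p b a = 0 := by rw [hpa]; simp [hab]
  have pbb : p b b = 1 := by rw [hpb]; simp
  have pbc : p b c = 0 := by rw [hpc]; simp [hbc.symm]
  have pca : p c a = 0 := by rw [hpa]; simp [hac]
  have pcb : p c b = 0 := by rw [hpb]; simp [hbc]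
  have pcc : p c c = 1 := by rw [hpc]; simp
  have hdecomp : ∀ r : V → L, (∀ i, i ≠ a → i ≠ b → i ≠ c → M.mulVec r i = 0) →
      r = r a • p a + r b • p b + r c • p c := by
    intro r hr
    rw [← sub_eq_zero]
    refine hinj _ ?_ ?_ ?_ ?_
    · simp [paa, pba, pca]
    · simp [pab, pbb, pcb]
    · simp [pac, pbc, pcc]
    · intro i ha hb hc
      rw [Matrix.mulVec_sub, Matrix.mulVec_add, Matrix.mulVec_add, Matrix.mulVec_smul,
        Matrix.mulVec_smul, Matrix.mulVec_smul]
      simp [hr i ha hb hc, hpi _ i ha hb hc ha, hpi _ i ha hb hc hb, hpi _ i ha hb hc hc]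
  let S : V → V → L := fun u v => M.mulVec (p v) u
  -- a relation: `r` with one coordinate zero
  have hmul : ∀ r : V → L, (∀ i, i ≠ a → i ≠ b → i ≠ c → M.mulVec r i = 0) → ∀ u,
      M.mulVec r u = r a * S u a + r b * S u b + r c * S u c := by
    intro r hr u
    conv_lhs => rw [hdecomp r hr]
    rw [Matrix.mulVec_add, Matrix.mulVec_add, Matrix.mulVec_smul,
        Matrix.mulVec_smul, Matrix.mulVec_smul]
    rfl
  have hdet : ∀ s t a1 a2 b1 b2 : L, (s ≠ 0 ∨ t ≠ 0) → s * a1 + t * a2 = 0 → s * b1 + t * b2 = 0 →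
      a1 * b2 = a2 * b1 := by
    intro s t a1 a2 b1 b2 h e1 e2
    rcases h with h | h
    · apply mul_left_cancel₀ h; linear_combination b2 * e1 - a2 * e2
    · apply mul_left_cancel₀ h; linear_combination a1 * e2 - b1 * e1
  -- (x,y) = (b,c): r c = 0, rows a, c
  have R1 : S a a * S c b = S a b * S c a := by
    obtain ⟨r, hr0, hrc, hr⟩ := pp_ker_of_det M b c h3
    have hr' : ∀ i, i ≠ a → i ≠ b → i ≠ c → M.mulVec r i = 0 := fun i _ h _ => hr i h
    have e1 := hmul r hr' a
    have e2 := hmul r hr' c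
    rw [hr a hab, hrc] at e1
    rw [hr c hbc.symm, hrc] at e2
    refine hdet (r a) (r b) _ _ _ _ ?_ (by linear_combination -e1) (by linear_combination -e2)
    by_contra hcon
    push Not at hcon
    exact hr0 (hinj r hcon.1 hcon.2 hrc hr')
  have R2 : S b a * S c b = S b b * S c a := by
    obtain ⟨r, hr0, hrc, hr⟩ := pp_ker_of_det M a c h2
    have hr' : ∀ i, i ≠ a → i ≠ b → i ≠ c → M.mulVec r i = 0 := fun i h _ _ => hr i h
    have e1 := hmul r hr' b
    have e2 := hmul r hr' c
    rw [hr b hab.symm, hrc] at e1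
    rw [hr c hac.symm, hrc] at e2
    refine hdet (r a) (r b) _ _ _ _ ?_ (by linear_combination -e1) (by linear_combination -e2)
    by_contra hcon
    push Not at hcon
    exact hr0 (hinj r hcon.1 hcon.2 hrc hr')
  have R3 : S a a * S b c = S a c * S b a := by
    obtain ⟨r, hr0, hrc, hr⟩ := pp_ker_of_det M c b h4
    have hr' : ∀ i, i ≠ a → i ≠ b → i ≠ c → M.mulVec r i = 0 := fun i _ _ h => hr i h
    have e1 := hmul r hr' a
    have e2 := hmul r hr' b
    rw [hr a hac, hrc] at e1
    rw [hr b hbc, hrc] at e2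
    refine hdet (r a) (r c) _ _ _ _ ?_ (by linear_combination -e1) (by linear_combination -e2)
    by_contra hcon
    push Not at hcon
    exact hr0 (hinj r hcon.1 hrc hcon.2 hr')
  have R4 : S b a * S c c = S b c * S c a := by
    obtain ⟨r, hr0, hrc, hr⟩ := pp_ker_of_det M a b h1
    have hr' : ∀ i, i ≠ a → i ≠ b → i ≠ c → M.mulVec r i = 0 := fun i h _ _ => hr i h
    have e1 := hmul r hr' b
    have e2 := hmul r hr' c
    rw [hr b hab.symm, hrc] at e1
    rw [hr c hac.symm, hrc] at e2
    refine hdet (r a) (r c) _ _ _ _ ?_ (by linear_combination -e1) (by linear_combination -e2)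
    by_contra hcon
    push Not at hcon
    exact hr0 (hinj r hcon.1 hrc hcon.2 hr')
  have hpane : p a ≠ 0 := fun h => by rw [h] at paa; simp at paa
  have hSca : S c a ≠ 0 := by
    intro h
    apply hA
    rw [← Matrix.exists_mulVec_eq_zero_iff]
    refine ⟨p a, hpane, ?_⟩
    ext i
    by_cases hi : i = b
    · subst hi; simp [Matrix.mulVec, pab]
    by_cases hi' : i = a
    · subst hi'; simp [Matrix.mulVec, pac, Matrix.updateRow_ne hi]
    have : M.mulVec (p a) i = 0 := by
      by_cases hi'' : i = c
      · rw [hi'']; exact h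
      · exact hpi a i hi' hi hi'' hi'
    simpa [Matrix.mulVec, Matrix.updateRow_ne hi, Matrix.updateRow_ne hi'] using this
  have hSba : S b a ≠ 0 := by
    intro h
    apply hB
    rw [← Matrix.exists_mulVec_eq_zero_iff]
    refine ⟨p a, hpane, ?_⟩
    ext i
    by_cases hi : i = c
    · subst hi; simp [Matrix.mulVec, pac]
    by_cases hi' : i = a
    · subst hi'; simp [Matrix.mulVec, pab, Matrix.updateRow_ne hi]
    have : M.mulVec (p a) i = 0 := by
      by_cases hi'' : i = b
      · rw [hi'']; exact h
      · exact hpi a i hi' hi'' hi hi'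
    simpa [Matrix.mulVec, Matrix.updateRow_ne hi, Matrix.updateRow_ne hi'] using this
  refine pp_det_zero_of_ker M b c (S c b • p a - S c a • p b) (S b c • p a - S b a • p c)
    ?_ ?_ ?_ ?_ ?_ ?_ x y
  · rw [Matrix.mulVec_sub, Matrix.mulVec_smul, Matrix.mulVec_smul]
    ext i
    change S c b * S i a - S c a * S i b = 0
    by_cases hi : i = a
    · subst hi; linear_combination R1
    by_cases hi' : i = b
    · subst hi'; linear_combination R2
    by_cases hi'' : i = c
    · subst hi''; ring
    have e1 : S i a = 0 := hpi a i hi hi' hi'' hi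
    have e2 : S i b = 0 := hpi b i hi hi' hi'' hi'
    rw [e1, e2]; ring
  · rw [Matrix.mulVec_sub, Matrix.mulVec_smul, Matrix.mulVec_smul]
    ext i
    change S b c * S i a - S b a * S i c = 0
    by_cases hi : i = a
    · subst hi; linear_combination R3
    by_cases hi' : i = b
    · subst hi'; ring
    by_cases hi'' : i = c
    · subst hi''; linear_combination -R4
    have e1 : S i a = 0 := hpi a i hi hi' hi'' hi
    have e2 : S i c = 0 := hpi c i hi hi' hi'' hi''
    rw [e1, e2]; ring
  · simp [pab, pbb, hSca]
  · simp [pac, pbc]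
  · simp [pab, pcb]
  · simp [pac, pcc, hSba]

/-! ### Forest combinatorics -/

lemma pp_pred_unique {V : Type*} (T : SimpleGraph V) (hT : T.IsAcyclic) (a i i' j : V)
    (h : T.Adj i j) (h' : T.Adj i' j) (hd : T.dist a j = T.dist a i + 1)
    (hd' : T.dist a j = T.dist a i' + 1) : i = i' := by
  have hr : T.Reachable a j := SimpleGraph.Reachable.of_dist_ne_zero (by omega)
  have hri : T.Reachable a i := hr.trans h.symm.reachable
  have hri' : T.Reachable a i' := hr.trans h'.symm.reachable
  obtain ⟨p, hp⟩ := hri.exists_walk_length_eq_dist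
  obtain ⟨p', hp'⟩ := hri'.exists_walk_length_eq_dist
  have h1 : (p.concat h).IsPath := SimpleGraph.Walk.isPath_of_length_eq_dist _ (by
    rw [SimpleGraph.Walk.length_concat]; omega)
  have h2 : (p'.concat h').IsPath := SimpleGraph.Walk.isPath_of_length_eq_dist _ (by
    rw [SimpleGraph.Walk.length_concat]; omega)
  have h3 := congrArg Subtype.val (hT.path_unique ⟨_, h1⟩ ⟨_, h2⟩)
  have h4 := congrArg SimpleGraph.Walk.penultimate h3
  simpa using h4

lemma pp_dist_lt {V : Type*} [Fintype V] (T : SimpleGraph V) (a j : V) :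
    T.dist a j < Fintype.card V := by
  by_cases h : T.Reachable a j
  · obtain ⟨p, hp, hl⟩ := h.exists_path_of_dist
    rw [← hl]
    exact hp.length_lt
  · rw [SimpleGraph.dist_eq_zero_of_not_reachable h]
    exact Fintype.card_pos_iff.mpr ⟨a⟩

lemma pp_pred_exists {V : Type*} (T : SimpleGraph V) (a j : V) (h : T.Reachable a j)
    (hne : a ≠ j) : ∃ i, T.Adj i j ∧ T.Reachable a i ∧ T.dist a j = T.dist a i + 1 := by
  obtain ⟨p, hp⟩ := h.exists_walk_length_eq_dist
  have hnil : ¬ p.Nil := fun h => hne h.eq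
  refine ⟨p.penultimate, p.adj_penultimate hnil, ⟨p.dropLast⟩, ?_⟩
  have h1 : T.dist a p.penultimate ≤ p.dropLast.length := SimpleGraph.dist_le _
  have h2 : p.dropLast.length + 1 = p.length := by
    have := congrArg SimpleGraph.Walk.length (p.concat_dropLast (p.adj_penultimate hnil))
    rwa [SimpleGraph.Walk.length_concat] at this
  have h3 : T.dist a j ≤ T.dist a p.penultimate + 1 := by
    have h4 : T.Reachable a p.penultimate := ⟨p.dropLast⟩
    obtain ⟨q, hq⟩ := h4.exists_walk_length_eq_dist
    have := SimpleGraph.dist_le (q.concat (p.adj_penultimate hnil))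
    rw [SimpleGraph.Walk.length_concat] at this
    omega
  omega

/-- tightness of a permutation -/
def pp_tight {V : Type*} (T : SimpleGraph V) (a b : V) (σ : Equiv.Perm V) : Prop :=
  σ b = a ∧ ∀ i, i ≠ b → σ i = i ∨ (T.Adj (σ i) i ∧ T.dist a (σ i) = T.dist a i + 1)

lemma pp_tight_exists {V : Type*} (T : SimpleGraph V) (a : V) (k : ℕ) :
    ∀ b, T.Reachable a b → T.dist a b = k → ∃ σ : Equiv.Perm V, pp_tight T a b σ ∧
      ∀ j, j ≠ b → T.dist a b ≤ T.dist a j → σ j = j := by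
  induction k with
  | zero =>
    intro b hr h0
    have hab : a = b := hr.dist_eq_zero_iff.mp h0
    subst hab
    exact ⟨1, ⟨rfl, fun i _ => Or.inl rfl⟩, fun j _ _ => rfl⟩
  | succ k ih =>
    intro b hr hk
    have hne : a ≠ b := by rintro rfl; simp at hk
    obtain ⟨i0, hadj, hr0, hd⟩ := pp_pred_exists T a b hr hne
    obtain ⟨σ0, ⟨h1, h2⟩, h3⟩ := ih i0 hr0 (by omega)
    have hbi : b ≠ i0 := hadj.ne.symm
    have hb : σ0 b = b := h3 b hbi (by omega)
    have hv1 : (σ0 * Equiv.swap i0 b) b = a := by simp [h1]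
    have hv2 : (σ0 * Equiv.swap i0 b) i0 = b := by simp [hb]
    have hv3 : ∀ j, j ≠ b → j ≠ i0 → (σ0 * Equiv.swap i0 b) j = σ0 j := by
      intro j h h'
      simp [Equiv.swap_apply_of_ne_of_ne h' h]
    refine ⟨σ0 * Equiv.swap i0 b, ⟨hv1, ?_⟩, ?_⟩
    · intro i hi
      by_cases hi0 : i = i0
      · subst hi0
        rw [hv2]
        exact Or.inr ⟨hadj.symm, hd⟩
      · rw [hv3 i hi hi0]
        exact h2 i hi0
    · intro j hj hle
      have hj0 : j ≠ i0 := by rintro rfl; omega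
      rw [hv3 j hj hj0]
      exact h3 j hj0 (by omega)

lemma pp_tight_unique {V : Type*} [Fintype V] (T : SimpleGraph V) (hT : T.IsAcyclic) (a b : V)
    (σ τ : Equiv.Perm V) (hσ : pp_tight T a b σ) (hτ : pp_tight T a b τ) : σ = τ := by
  by_contra hne
  have h1 : ∃ j, σ.symm j ≠ τ.symm j := by
    by_contra hcon
    push Not at hcon
    apply hne
    have : σ.symm = τ.symm := Equiv.ext hcon
    simpa using congrArg Equiv.symm this
  let D : Finset V := Finset.univ.filter fun j => σ.symm j ≠ τ.symm j
  have hD : D.Nonempty := by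
    obtain ⟨j, hj⟩ := h1
    exact ⟨j, by simp [D, hj]⟩
  obtain ⟨j, hjD, hmax⟩ := Finset.exists_max_image D (fun j => T.dist a j) hD
  have hj : σ.symm j ≠ τ.symm j := by simpa [D] using hjD
  -- generic step
  have step : ∀ σ τ : Equiv.Perm V, pp_tight T a b σ → pp_tight T a b τ →
      (∀ i, T.dist a j < T.dist a i → σ.symm i = τ.symm i) → j ≠ a → σ j = j → τ j = j := by
    intro σ τ hσ hτ hm hja hs
    by_contra ht
    have hjb : j ≠ b := by
      rintro rfl
      exact hja (hs.symm.trans hσ.1)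
    rcases hτ.2 j hjb with h | ⟨h, hd⟩
    · exact ht h
    · have := hm (τ j) (by omega)
      rw [Equiv.symm_apply_apply, Equiv.symm_apply_eq, hs] at this
      exact ht this
  have hm1 : ∀ i, T.dist a j < T.dist a i → σ.symm i = τ.symm i := by
    intro i hi
    by_contra hcon
    have := hmax i (by simp [D, hcon])
    omega
  have hja : j ≠ a := by
    rintro rfl
    apply hj
    have e1 : σ.symm j = b := by rw [Equiv.symm_apply_eq, hσ.1]
    have e2 : τ.symm j = b := by rw [Equiv.symm_apply_eq, hτ.1]
    rw [e1, e2]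
  by_cases hs : σ j = j
  · have ht := step σ τ hσ hτ hm1 hja hs
    apply hj
    have e1 : σ.symm j = j := by rw [Equiv.symm_apply_eq, hs]
    have e2 : τ.symm j = j := by rw [Equiv.symm_apply_eq, ht]
    rw [e1, e2]
  · have ht : τ j ≠ j := fun ht =>
      hs (step τ σ hτ hσ (fun i hi => (hm1 i hi).symm) hja ht)
    have aux : ∀ σ : Equiv.Perm V, pp_tight T a b σ → σ j ≠ j →
        T.Adj (σ.symm j) j ∧ T.dist a j = T.dist a (σ.symm j) + 1 := by
      intro σ hσ hs
      have hb : σ.symm j ≠ b := by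
        intro h
        rw [Equiv.symm_apply_eq, hσ.1] at h
        exact hja h
      have := hσ.2 (σ.symm j) hb
      rw [Equiv.apply_symm_apply] at this
      rcases this with h | ⟨h, h'⟩
      · exact absurd ((Equiv.symm_apply_eq σ).mp h.symm).symm hs
      · exact ⟨h.symm, h'⟩
    obtain ⟨a1, a2⟩ := aux σ hσ hs
    obtain ⟨b1, b2⟩ := aux τ hτ ht
    exact hj (pp_pred_unique T hT a _ _ j a1 b1 a2 b2)

/-- cost of a variable -/
noncomputable def pp_c {V : Type*} [Fintype V] (T : SimpleGraph V) (z : Sym2 V) : ℕ :=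
  if z.IsDiag then 0 else if z ∈ T.edgeSet then 1 else Fintype.card V

/-- admissible permutations -/
def pp_valid {V : Type*} (G : SimpleGraph V) (a b : V) (σ : Equiv.Perm V) : Prop :=
  σ b = a ∧ ∀ i, i ≠ b → σ i = i ∨ G.Adj (σ i) i

lemma pp_cost_step {V : Type*} [Fintype V] (T G : SimpleGraph V)
    (hTG : ∀ i j, G.Adj i j → T.Reachable i j) (a i j : V) (h : j = i ∨ G.Adj j i) :
    T.dist a j ≤ T.dist a i + pp_c T s(j, i) ∧
      (T.dist a j = T.dist a i + pp_c T s(j, i) →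
        j = i ∨ (T.Adj j i ∧ T.dist a j = T.dist a i + 1)) := by
  rcases h with rfl | h
  · simp [pp_c]
  · by_cases hT : T.Adj j i
    · have hc : pp_c T s(j, i) = 1 := by simp [pp_c, hT, hT.ne]
      rw [hc]
      refine ⟨?_, fun h => Or.inr ⟨hT, h⟩⟩
      have := hT.symm.reachable.dist_triangle_right a
      rw [SimpleGraph.dist_eq_one_iff_adj.mpr hT.symm] at this
      exact this
    · have hc : pp_c T s(j, i) = Fintype.card V := by simp [pp_c, hT, h.ne]
      have := pp_dist_lt T a j
      rw [hc]
      exact ⟨by omega, fun h => by omega⟩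

lemma pp_cost {V : Type*} [Fintype V] (T G : SimpleGraph V)
    (hTG : ∀ i j, G.Adj i j → T.Reachable i j) (a b : V) (σ : Equiv.Perm V)
    (hσ : pp_valid G a b σ) :
    T.dist a b ≤ ∑ i ∈ Finset.univ.erase b, pp_c T s(σ i, i) ∧
      (∑ i ∈ Finset.univ.erase b, pp_c T s(σ i, i) = T.dist a b → pp_tight T a b σ) := by
  have h1 : ∑ i ∈ Finset.univ.erase b, T.dist a (σ i) = ∑ i, T.dist a i := by
    rw [← Equiv.sum_comp σ, ← Finset.add_sum_erase _ _ (Finset.mem_univ b), hσ.1,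
      SimpleGraph.dist_self, zero_add]
  have h2 : T.dist a b + ∑ i ∈ Finset.univ.erase b, T.dist a i = ∑ i, T.dist a i :=
    Finset.add_sum_erase _ _ (Finset.mem_univ b)
  have h3 : ∀ i ∈ Finset.univ.erase b, T.dist a (σ i) ≤ T.dist a i + pp_c T s(σ i, i) :=
    fun i hi => (pp_cost_step T G hTG a i (σ i) (hσ.2 i (Finset.ne_of_mem_erase hi))).1
  have h4 := Finset.sum_le_sum h3
  rw [Finset.sum_add_distrib] at h4
  refine ⟨by omega, fun h => ⟨hσ.1, fun i hi => ?_⟩⟩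
  have h5 := (Finset.sum_eq_sum_iff_of_le h3).mp (by rw [Finset.sum_add_distrib]; omega) i
    (by simp [hi])
  exact (pp_cost_step T G hTG a i (σ i) (hσ.2 i hi)).2 h5

lemma pp_cost_tight {V : Type*} [Fintype V] (T : SimpleGraph V) (a b : V) (σ : Equiv.Perm V)
    (hσ : pp_tight T a b σ) :
    ∑ i ∈ Finset.univ.erase b, pp_c T s(σ i, i) = T.dist a b := by
  have h1 : ∑ i ∈ Finset.univ.erase b, T.dist a (σ i) = ∑ i, T.dist a i := by
    rw [← Equiv.sum_comp σ, ← Finset.add_sum_erase _ _ (Finset.mem_univ b), hσ.1,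
      SimpleGraph.dist_self, zero_add]
  have h2 : T.dist a b + ∑ i ∈ Finset.univ.erase b, T.dist a i = ∑ i, T.dist a i :=
    Finset.add_sum_erase _ _ (Finset.mem_univ b)
  have h3 : ∀ i ∈ Finset.univ.erase b, T.dist a (σ i) = T.dist a i + pp_c T s(σ i, i) := by
    intro i hi
    rcases hσ.2 i (Finset.ne_of_mem_erase hi) with h | ⟨h, h'⟩
    · rw [h]; simp [pp_c]
    · rw [h']; simp [pp_c, h, h.ne]
  have h4 := Finset.sum_congr rfl h3
  rw [Finset.sum_add_distrib] at h4
  omega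

lemma pp_valid_reach {V : Type*} [Fintype V] (T G : SimpleGraph V)
    (hTG : ∀ i j, G.Adj i j → T.Reachable i j) (a b : V) (σ : Equiv.Perm V)
    (hσ : pp_valid G a b σ) : T.Reachable a b := by
  by_contra hcon
  let S : Finset V := Finset.univ.filter fun i => T.Reachable a i
  have hb : b ∉ S := by simp [S, hcon]
  have hmap : S.map σ.toEmbedding ⊆ S := by
    intro x hx
    obtain ⟨i, hi, rfl⟩ := Finset.mem_map.mp hx
    have hia : T.Reachable a i := by simpa [S] using hi
    have hib : i ≠ b := by rintro rfl; exact hb hi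
    have : T.Reachable a (σ i) := by
      rcases hσ.2 i hib with h | h
      · rw [h]; exact hia
      · exact hia.trans (hTG _ _ h).symm
    simpa [S] using this
  have heq := Finset.eq_of_subset_of_card_le hmap (by simp)
  have ha : a ∈ S := by simp [S]
  rw [← heq] at ha
  obtain ⟨i, hi, hia⟩ := Finset.mem_map.mp ha
  have : i = b := σ.injective (by rw [hσ.1]; exact hia)
  exact hb (this ▸ hi)

/-- exponent vector of a permutation -/
noncomputable def pp_mon {V : Type*} [Fintype V] (b : V) (σ : Equiv.Perm V) : Sym2 V →₀ ℕ :=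
  ∑ i ∈ Finset.univ.erase b, Finsupp.single s(σ i, i) 1

lemma pp_mon_apply {V : Type*} [Fintype V] (b : V) (σ : Equiv.Perm V) (z : Sym2 V) :
    pp_mon b σ z = ((Finset.univ.erase b).filter fun i => s(σ i, i) = z).card := by
  rw [pp_mon, Finsupp.finset_sum_apply, Finset.card_filter]
  exact Finset.sum_congr rfl fun i _ => by rw [Finsupp.single_apply]

lemma pp_mon_diag {V : Type*} [Fintype V] (b : V) (σ : Equiv.Perm V) (c : V) :
    pp_mon b σ s(c, c) = if c ≠ b ∧ σ c = c then 1 else 0 := by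
  rw [pp_mon_apply]
  have : ((Finset.univ.erase b).filter fun i => s(σ i, i) = s(c, c)) =
      if c ≠ b ∧ σ c = c then {c} else ∅ := by
    split_ifs with h
    · ext i
      simp only [Finset.mem_filter, Finset.mem_erase, Finset.mem_univ, and_true, Sym2.eq_iff,
        Finset.mem_singleton]
      constructor
      · rintro ⟨-, h | h⟩
        · exact h.2
        · exact h.2
      · rintro rfl
        exact ⟨h.1, Or.inl ⟨h.2, rfl⟩⟩
    · ext i
      simp only [Finset.mem_filter, Finset.mem_erase, Finset.mem_univ, and_true, Sym2.eq_iff,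
        Finset.notMem_empty, iff_false]
      rintro ⟨hi, h'⟩
      have h2 : σ i = c ∧ i = c := by rcases h' with h' | h' <;> exact h'
      obtain ⟨h3, rfl⟩ := h2
      exact h ⟨hi, h3⟩
  rw [this]
  split_ifs <;> simp

lemma pp_mon_offdiag {V : Type*} [Fintype V] (T : SimpleGraph V) (a b : V) (σ : Equiv.Perm V)
    (hσ : pp_tight T a b σ) (z : Sym2 V) (hz : ¬ z.IsDiag) : pp_mon b σ z ≤ 1 := by
  rw [pp_mon_apply, Finset.card_le_one]
  intro i hi j hj
  simp only [Finset.mem_filter, Finset.mem_erase, Finset.mem_univ, and_true] at hi hj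
  have h1 : s(σ i, i) = s(σ j, j) := hi.2.trans hj.2.symm
  rw [Sym2.eq_iff] at h1
  rcases h1 with h1 | h1
  · exact h1.2
  · exfalso
    have hne : σ i ≠ i := by
      intro h
      apply hz
      rw [← hi.2, h]; simp
    have hne' : σ j ≠ j := by
      intro h
      apply hz
      rw [← hj.2, h]; simp
    have e1 := (hσ.2 i hi.1).resolve_left hne
    have e2 := (hσ.2 j hj.1).resolve_left hne'
    rw [h1.1] at e1
    rw [← h1.2] at e2
    omega

lemma pp_cst_mon {V : Type*} [Fintype V] (c : Sym2 V → ℕ) (b : V) (σ : Equiv.Perm V) :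
    pp_cst c (pp_mon b σ) = ∑ i ∈ Finset.univ.erase b, c s(σ i, i) := by
  simp only [pp_cst, pp_mon, Finsupp.finset_sum_apply, Finset.mul_sum]
  rw [Finset.sum_comm]
  refine Finset.sum_congr rfl fun i _ => ?_
  rw [Finset.sum_eq_single s(σ i, i)]
  · simp
  · intro z _ hz
    rw [Finsupp.single_apply, if_neg hz.symm, mul_zero]
  · simp

lemma pp_deg_mon {V : Type*} [Fintype V] (b : V) (σ : Equiv.Perm V) :
    ∑ z, pp_mon b σ z = Fintype.card V - 1 := by
  have := pp_cst_mon (fun _ => 1) b σ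
  simp only [pp_cst, one_mul] at this
  rw [this]
  simp [Finset.card_erase_of_mem]

/-! ### Leibniz expansion of the submaximal minors -/

/-- the sparse generic symmetric matrix on a general vertex set -/
noncomputable def pp_X (K : Type*) {V : Type*} [Field K] (G : SimpleGraph V) :
    Matrix V V (MvPolynomial (Sym2 V) K) :=
  fun i j => if i = j ∨ G.Adj i j then MvPolynomial.X s(i, j) else 0

/-- signed minors -/
noncomputable def pp_P (K : Type*) {V : Type*} [Field K] [Fintype V] (G : SimpleGraph V) (a b : V) :
    MvPolynomial (Sym2 V) K :=
  ((pp_X K G).updateRow a (Pi.single b 1)).det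

lemma pp_P_eq (K : Type*) {V : Type*} [Field K] [Fintype V] (G : SimpleGraph V) (a b : V) :
    pp_P K G a b = ∑ σ : Equiv.Perm V with pp_valid G a b σ,
      monomial (pp_mon b σ) (((Equiv.Perm.sign σ : ℤ) : K)) := by
  rw [pp_P, Matrix.det_apply', Finset.sum_filter]
  refine Finset.sum_congr rfl fun σ _ => ?_
  by_cases hb : σ b = a
  · have hne : ∀ i, i ≠ b → σ i ≠ a := fun i hi h => hi (σ.injective (h.trans hb.symm))
    rw [← Finset.mul_prod_erase _ _ (Finset.mem_univ b), hb, Matrix.updateRow_self,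
      Pi.single_eq_same, one_mul]
    split_ifs with hv
    · rw [Finset.prod_congr rfl (g := fun i => monomial (Finsupp.single s(σ i, i) 1) (1 : K))]
      · rw [← monomial_sum_one, ← pp_mon]
        rw [show ((Equiv.Perm.sign σ : ℤ) : MvPolynomial (Sym2 V) K)
          = C (((Equiv.Perm.sign σ : ℤ) : K)) by simp]
        rw [C_mul_monomial, mul_one]
      · intro i hi
        have hi' := Finset.ne_of_mem_erase hi
        rw [Matrix.updateRow_ne (hne i hi'), pp_X, if_pos (hv.2 i hi')]
        rfl
    · have : ∃ i, i ≠ b ∧ ¬ (σ i = i ∨ G.Adj (σ i) i) := by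
        by_contra hcon
        push Not at hcon
        exact hv ⟨hb, fun i hi => by
          by_contra h
          push Not at h
          have := hcon i hi
          tauto⟩
      obtain ⟨i, hi, hi2⟩ := this
      rw [Finset.prod_eq_zero (i := i) (by simp [hi]), mul_zero]
      rw [Matrix.updateRow_ne (hne i hi), pp_X, if_neg hi2]
  · rw [if_neg (fun h => hb h.1)]
    rw [Finset.prod_eq_zero (Finset.mem_univ (σ.symm a)), mul_zero]
    rw [Equiv.apply_symm_apply, Matrix.updateRow_self, Pi.single_eq_of_ne]
    intro h
    exact hb (by rw [← h]; simp)

lemma pp_P_support (K : Type*) {V : Type*} [Field K] [Fintype V] (G : SimpleGraph V) (a b : V)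
    (m : Sym2 V →₀ ℕ) (hm : m ∈ (pp_P K G a b).support) :
    ∃ σ, pp_valid G a b σ ∧ m = pp_mon b σ := by
  by_contra hcon
  push Not at hcon
  rw [mem_support_iff] at hm
  apply hm
  rw [pp_P_eq, coeff_sum]
  refine Finset.sum_eq_zero fun σ hσ => ?_
  rw [coeff_monomial, if_neg]
  exact fun h => hcon σ (Finset.mem_filter.mp hσ).2 h.symm

lemma pp_P_not_reach (K : Type*) {V : Type*} [Field K] [Fintype V] (T G : SimpleGraph V)
    (hTG : ∀ i j, G.Adj i j → T.Reachable i j) (a b : V) (h : ¬ T.Reachable a b) :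
    pp_P K G a b = 0 := by
  rw [pp_P_eq]
  refine Finset.sum_eq_zero fun σ hσ => ?_
  exact absurd (pp_valid_reach T G hTG a b σ (Finset.mem_filter.mp hσ).2) h

lemma pp_valid_of_tight {V : Type*} (T G : SimpleGraph V) (hle : T ≤ G) (a b : V)
    (σ : Equiv.Perm V) (h : pp_tight T a b σ) : pp_valid G a b σ :=
  ⟨h.1, fun i hi => (h.2 i hi).imp id fun h => hle h.1⟩

lemma pp_P_lead (K : Type*) {V : Type*} [Field K] [Fintype V] (T G : SimpleGraph V)
    (hT : T.IsAcyclic) (hle : T ≤ G)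
    (hTG : ∀ i j, G.Adj i j → T.Reachable i j) (a b : V) (σ : Equiv.Perm V)
    (hσ : pp_tight T a b σ) :
    (∀ m ∈ (pp_P K G a b).support, m ≠ pp_mon b σ →
      pp_cst (pp_c T) (pp_mon b σ) < pp_cst (pp_c T) m) ∧
    coeff (pp_mon b σ) (pp_P K G a b) ≠ 0 := by
  have key : ∀ τ, pp_valid G a b τ →
      pp_cst (pp_c T) (pp_mon b τ) ≤ pp_cst (pp_c T) (pp_mon b σ) → τ = σ := by
    intro τ hτ h
    rw [pp_cst_mon, pp_cst_mon, pp_cost_tight T a b σ hσ] at h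
    have h2 := pp_cost T G hTG a b τ hτ
    exact pp_tight_unique T hT a b τ σ (h2.2 (le_antisymm h h2.1)) hσ
  constructor
  · intro m hm hne
    obtain ⟨τ, hτ, rfl⟩ := pp_P_support K G a b m hm
    by_contra hcon
    exact hne (by rw [key τ hτ (not_lt.mp hcon)])
  · rw [pp_P_eq, coeff_sum, Finset.sum_eq_single σ]
    · rw [coeff_monomial, if_pos rfl]
      rcases Int.units_eq_one_or (Equiv.Perm.sign σ) with h | h <;> simp [h]
    · intro τ hτ hne
      rw [coeff_monomial, if_neg]
      intro h
      exact hne (key τ (Finset.mem_filter.mp hτ).2 (by rw [h]))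
    · intro h
      exact absurd (Finset.mem_filter.mpr ⟨Finset.mem_univ _, pp_valid_of_tight T G hle a b σ hσ⟩) h

/-! ### Evaluated matrices -/

/-- evaluation of the generic matrix -/
noncomputable def pp_M {V S : Type*} [CommRing S] (G : SimpleGraph V)
    (ξ : Sym2 V → S) : Matrix V V S :=
  fun i j => if i = j ∨ G.Adj i j then ξ s(i, j) else 0

lemma pp_map_updateRow {V S L : Type*} [CommRing S] [CommRing L] (φ : S →+* L)
    (N : Matrix V V S) (a b : V) :
    (N.updateRow a (Pi.single b 1)).map φ = (N.map φ).updateRow a (Pi.single b 1) := by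
  ext i j
  by_cases hi : i = a
  · subst hi
    by_cases hj : j = b
    · subst hj; simp
    · simp [Pi.single_eq_of_ne hj]
  · simp [Matrix.updateRow_ne hi]

lemma pp_det_map {V S L : Type*} [Fintype V] [CommRing S] [CommRing L] (φ : S →+* L)
    (N : Matrix V V S) : (N.map φ).det = φ N.det := by
  rw [RingHom.map_det]; rfl

lemma pp_aeval_P {K V S : Type*} [Field K] [Fintype V] [CommRing S] [Algebra K S]
    (G : SimpleGraph V) (ξ : Sym2 V → S) (a b : V) :
    aeval ξ (pp_P K G a b) = ((pp_M G ξ).updateRow a (Pi.single b 1)).det := by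
  have h : (pp_X K G).map (aeval (R := K) ξ).toRingHom = pp_M G ξ := by
    ext i j
    simp only [Matrix.map_apply, pp_X, pp_M]
    split_ifs <;> simp
  rw [← h, ← pp_map_updateRow, pp_det_map]
  rfl

lemma pp_M_symm {V S : Type*} [CommRing S] (G : SimpleGraph V) (ξ : Sym2 V → S) :
    (pp_M G ξ).transpose = pp_M G ξ := by
  ext i j
  simp only [Matrix.transpose_apply, pp_M]
  rw [Sym2.eq_swap, G.adj_comm j i, eq_comm (a := j) (b := i)]

lemma pp_det_symm {V S : Type*} [Fintype V] [CommRing S] (M : Matrix V V S)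
    (hM : M.transpose = M) (a b : V) :
    (M.updateRow a (Pi.single b 1)).det = (M.updateRow b (Pi.single a 1)).det := by
  rw [← Matrix.adjugate_apply, ← Matrix.adjugate_apply]
  conv_lhs => rw [← hM, ← Matrix.adjugate_transpose]
  rfl

lemma pp_det_ne {V F : Type*} [Fintype V] [Field F] (N : Matrix V V (PowerSeries F))
    (h1 : ∀ i j, i ≠ j → PowerSeries.constantCoeff (N i j) = 0)
    (h2 : ∀ i, PowerSeries.constantCoeff (N i i) ≠ 0) : N.det ≠ 0 := by
  intro h
  have h3 := congrArg PowerSeries.constantCoeff h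
  rw [← pp_det_map] at h3
  have h4 : N.map (PowerSeries.constantCoeff (R := F)) =
      Matrix.diagonal fun i => PowerSeries.constantCoeff (N i i) := by
    ext i j
    by_cases hij : i = j
    · subst hij; simp
    · simp [hij, h1 i j hij]
  rw [h4, Matrix.det_diagonal, map_zero, Finset.prod_eq_zero_iff] at h3
  obtain ⟨i, -, hi⟩ := h3
  exact h2 i hi

lemma pp_M_const_off {V F : Type*} [Fintype V] [Field F] (T G : SimpleGraph V)
    (η : Sym2 V → PowerSeries F) (i j : V) (hij : i ≠ j) :
    PowerSeries.constantCoeff (pp_M G (pp_pt (pp_c T) η) i j) = 0 := by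
  have hc : pp_c T s(i, j) ≠ 0 := by
    have : Fintype.card V ≠ 0 := (Fintype.card_pos_iff.mpr ⟨i⟩).ne'
    simp only [pp_c, Sym2.isDiag_iff_proj_eq, hij, if_false]
    split_ifs <;> simp
    exact this
  simp only [pp_M, pp_pt]
  split_ifs
  · simp [hc]
  · simp

lemma pp_M_diag {V F : Type*} [Fintype V] [Field F] (T G : SimpleGraph V)
    (η : Sym2 V → PowerSeries F) (i : V) :
    pp_M G (pp_pt (pp_c T) η) i i = η s(i, i) := by
  simp [pp_M, pp_pt, pp_c]

lemma pp_van1 {K V F : Type*} [Fintype V] [Field K] [Field F] [Algebra K F] (T G : SimpleGraph V)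
    (η : Sym2 V → PowerSeries F) (a b : V) (hab : a ≠ b)
    (hη : ∀ i, i ≠ a → i ≠ b → PowerSeries.constantCoeff (η s(i, i)) ≠ 0)
    (haa : aeval (pp_pt (pp_c T) η) (pp_P K G a a) = 0)
    (hbb : aeval (pp_pt (pp_c T) η) (pp_P K G b b) = 0)
    (h1 : aeval (pp_pt (pp_c T) η) (pp_P K G a b) = 0) (x y : V) :
    aeval (pp_pt (pp_c T) η) (pp_P K G x y) = 0 := by
  rw [pp_aeval_P] at *
  have h2 := h1
  rw [pp_det_symm _ (pp_M_symm G _)] at h2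
  have hN : (((pp_M G (pp_pt (pp_c T) η)).updateRow a (Pi.single a 1)).updateRow b
      (Pi.single b 1)).det ≠ 0 := by
    apply pp_det_ne
    · intro i j hij
      simp only [Matrix.updateRow_apply]
      split_ifs with h h'
      · subst h; rw [Pi.single_eq_of_ne hij.symm, map_zero]
      · subst h'; rw [Pi.single_eq_of_ne hij.symm, map_zero]
      · exact pp_M_const_off T G η i j hij
    · intro i
      simp only [Matrix.updateRow_apply]
      split_ifs with h h'
      · subst h; simp
      · subst h'; simp
      · rw [pp_M_diag]; exact hη i h' h
  generalize pp_M G (pp_pt (pp_c T) η) = M at *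
  have hinj := IsFractionRing.injective (PowerSeries F) (FractionRing (PowerSeries F))
  set φ := algebraMap (PowerSeries F) (FractionRing (PowerSeries F))
  have := pp_LA1 (M.map φ) a b hab
  simp only [← pp_map_updateRow, pp_det_map] at this
  exact (map_eq_zero_iff φ hinj).mp (this ((map_ne_zero_iff φ hinj).mpr hN) (by rw [haa, map_zero])
    (by rw [hbb, map_zero]) (by rw [h1, map_zero]) (by rw [h2, map_zero]) x y)

lemma pp_van2 {K V F : Type*} [Fintype V] [Field K] [Field F] [Algebra K F] (T G : SimpleGraph V)
    (η : Sym2 V → PowerSeries F) (a b c : V) (hab : a ≠ b) (hac : a ≠ c) (hbc : b ≠ c)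
    (hη : ∀ i, i ≠ a → i ≠ b → i ≠ c → PowerSeries.constantCoeff (η s(i, i)) ≠ 0)
    (hA : (((pp_M G (pp_pt (pp_c T) η)).updateRow a (Pi.single c 1)).updateRow b
      (Pi.single b 1)).det ≠ 0)
    (hB : (((pp_M G (pp_pt (pp_c T) η)).updateRow a (Pi.single b 1)).updateRow c
      (Pi.single c 1)).det ≠ 0)
    (h1 : aeval (pp_pt (pp_c T) η) (pp_P K G a b) = 0)
    (h2 : aeval (pp_pt (pp_c T) η) (pp_P K G a c) = 0)
    (h3 : aeval (pp_pt (pp_c T) η) (pp_P K G b c) = 0) (x y : V) :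
    aeval (pp_pt (pp_c T) η) (pp_P K G x y) = 0 := by
  rw [pp_aeval_P] at *
  have h4 := h3
  rw [pp_det_symm _ (pp_M_symm G _)] at h4
  have hN : ((((pp_M G (pp_pt (pp_c T) η)).updateRow a (Pi.single a 1)).updateRow b
      (Pi.single b 1)).updateRow c (Pi.single c 1)).det ≠ 0 := by
    apply pp_det_ne
    · intro i j hij
      simp only [Matrix.updateRow_apply]
      split_ifs with h h' h''
      · subst h; rw [Pi.single_eq_of_ne hij.symm, map_zero]
      · subst h'; rw [Pi.single_eq_of_ne hij.symm, map_zero]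
      · subst h''; rw [Pi.single_eq_of_ne hij.symm, map_zero]
      · exact pp_M_const_off T G η i j hij
    · intro i
      simp only [Matrix.updateRow_apply]
      split_ifs with h h' h''
      · subst h; simp
      · subst h'; simp
      · subst h''; simp
      · rw [pp_M_diag]; exact hη i h'' h' h
  generalize pp_M G (pp_pt (pp_c T) η) = M at *
  have hinj := IsFractionRing.injective (PowerSeries F) (FractionRing (PowerSeries F))
  set φ := algebraMap (PowerSeries F) (FractionRing (PowerSeries F))
  have := pp_LA2 (M.map φ) a b c hab hac hbc
  simp only [← pp_map_updateRow, pp_det_map] at this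
  exact (map_eq_zero_iff φ hinj).mp (this ((map_ne_zero_iff φ hinj).mpr hN)
    ((map_ne_zero_iff φ hinj).mpr hA) ((map_ne_zero_iff φ hinj).mpr hB)
    (by rw [h1, map_zero])
    (by rw [h2, map_zero]) (by rw [h3, map_zero]) (by rw [h4, map_zero]) x y)

/-- changing one diagonal variable -/
lemma pp_change {K V F : Type*} [Fintype V] [Field K] [Field F] [Algebra K F] (T G : SimpleGraph V)
    (η : Sym2 V → PowerSeries F) (a b c : V) (hac : a ≠ c) (u : PowerSeries F)
    (h1 : aeval (pp_pt (pp_c T) η) (pp_P K G a b) = 0)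
    (h2 : (((pp_M G (pp_pt (pp_c T) η)).updateRow a (Pi.single b 1)).updateRow c
      (Pi.single c 1)).det = 0) :
    aeval (pp_pt (pp_c T) (Function.update η s(c, c) u)) (pp_P K G a b) = 0 := by
  rw [pp_aeval_P] at *
  set M := pp_M G (pp_pt (pp_c T) η) with hM
  have hM' : pp_M G (pp_pt (pp_c T) (Function.update η s(c, c) u)) =
      M.updateRow c (M c + (u - η s(c, c)) • Pi.single c 1) := by
    ext1 i j
    by_cases hi : i = c
    · subst hi
      rw [Matrix.updateRow_self]
      by_cases hj : j = i
      · subst hj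
        rw [Pi.add_apply, hM, pp_M_diag, pp_M_diag]
        simp
      · rw [Pi.add_apply, Pi.smul_apply, Pi.single_eq_of_ne hj, smul_zero, add_zero, hM]
        simp only [pp_M, pp_pt]
        rw [Function.update_of_ne]
        intro h
        rw [Sym2.eq_iff] at h
        tauto
    · rw [Matrix.updateRow_ne hi, hM]
      simp only [pp_M, pp_pt]
      rw [Function.update_of_ne]
      intro h
      rw [Sym2.eq_iff] at h
      tauto
  rw [hM', Matrix.updateRow_comm _ hac.symm, Matrix.det_updateRow_add, Matrix.det_updateRow_smul,
    h2, mul_zero, add_zero]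
  rw [← h1]
  congr 1
  rw [Matrix.updateRow_comm _ hac, Matrix.updateRow_eq_self]

/-! ### The main radicality statement -/

theorem pp_main (K : Type*) {V : Type} [Field K] [Fintype V] [Nonempty V] (G : SimpleGraph V) :
    (Ideal.span (Set.range fun ab : V × V => pp_P K G ab.1 ab.2)).IsRadical := by
  obtain ⟨T, hle, hT, hreach⟩ := G.exists_isAcyclic_reachable_eq_le
  have hTG : ∀ i j, G.Adj i j → T.Reachable i j := by
    intro i j h
    rw [hreach]
    exact h.reachable
  let J := {ab : V × V // T.Reachable ab.1 ab.2}
  let jj : ∀ a b, T.Reachable a b → J := fun a b h => ⟨(a, b), h⟩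
  obtain ⟨v0⟩ := ‹Nonempty V›
  haveI : Nonempty J := ⟨jj v0 v0 (SimpleGraph.Reachable.refl _)⟩
  choose σ hσt hσf using fun j : J => pp_tight_exists T j.1.1 _ j.1.2 j.2 rfl
  let p : J → MvPolynomial (Sym2 V) K := fun j => pp_P K G j.1.1 j.1.2
  let g : J → Sym2 V →₀ ℕ := fun j => pp_mon j.1.2 (σ j)
  have hspan : Ideal.span (Set.range fun ab : V × V => pp_P K G ab.1 ab.2) =
      Ideal.span (Set.range p) := by
    apply le_antisymm
    · rw [Ideal.span_le]
      rintro _ ⟨⟨a, b⟩, rfl⟩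
      by_cases h : T.Reachable a b
      · exact Ideal.subset_span ⟨jj a b h, rfl⟩
      · simp only [pp_P_not_reach K T G hTG a b h]
        exact Ideal.zero_mem _
    · apply Ideal.span_mono
      rintro _ ⟨j, rfl⟩
      exact ⟨j.1, rfl⟩
  rw [hspan]
  have hlead := fun j : J => pp_P_lead K T G hT hle hTG j.1.1 j.1.2 (σ j) (hσt j)
  have hdiag : ∀ (j : J) (c : V), g j s(c, c) = if c ≠ j.1.2 ∧ σ j c = c then 1 else 0 :=
    fun j c => pp_mon_diag _ _ _
  have hrr : ∀ a, T.Reachable a a := fun a => SimpleGraph.Reachable.refl a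
  have hfix : ∀ a c, c ≠ a → σ (jj a a (hrr a)) c = c := by
    intro a c hc
    exact hσf (jj a a (hrr a)) c hc (by simp [jj])
  have hoff : ∀ a z, ¬ z.IsDiag → g (jj a a (hrr a)) z = 0 := by
    intro a z hz
    have h0 : pp_mon a (σ (jj a a (hrr a))) z = 0 := by
      rw [pp_mon_apply, Finset.card_eq_zero, Finset.filter_eq_empty_iff]
      intro i hi h
      rw [hfix a i (Finset.ne_of_mem_erase hi)] at h
      exact hz (h ▸ Sym2.diag_isDiag i)
    exact h0
  have hself : ∀ a c, c ≠ a → g (jj a a (hrr a)) s(c, c) = 1 := by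
    intro a c hc
    rw [hdiag, if_pos ⟨hc, hfix a c hc⟩]
  have hself0 : ∀ a, g (jj a a (hrr a)) s(a, a) = 0 := by
    intro a
    rw [hdiag, if_neg]
    exact fun h => h.1 rfl
  have hmove : ∀ a b (h : T.Reachable a b), a ≠ b → σ (jj a b h) a ≠ a := by
    intro a b h hab h1
    have h2 : σ (jj a b h) b = a := (hσt (jj a b h)).1
    exact hab ((σ (jj a b h)).injective (h1.trans h2.symm))
  have hga : ∀ a b (h : T.Reachable a b), a ≠ b → g (jj a b h) s(a, a) = 0 := by
    intro a b h hab
    rw [hdiag, if_neg]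
    exact fun h' => hmove a b h hab h'.2
  have hgb : ∀ a b (h : T.Reachable a b), g (jj a b h) s(b, b) = 0 := by
    intro a b h
    rw [hdiag, if_neg]
    exact fun h' => h'.1 rfl
  have hgc : ∀ a b c (h : T.Reachable a b), c ≠ b → σ (jj a b h) c = c →
      g (jj a b h) s(c, c) = 1 := by
    intro a b c h hc h1
    rw [hdiag, if_pos ⟨hc, h1⟩]
  have hss : ∀ a b : V, a ≠ b → s(a, a) ≠ s(b, b) := by
    intro a b hab h
    rw [Sym2.eq_iff] at h
    tauto
  have hcle : ∀ z, pp_c T z ≤ Fintype.card V := by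
    intro z
    have : 0 < Fintype.card V := Fintype.card_pos_iff.mpr ⟨v0⟩
    unfold pp_c
    split_ifs <;> omega
  refine pp_radical (pp_c T) (fun z => Fintype.card V - pp_c T z) (Fintype.card V)
    (fun z => by have := hcle z; omega) p g (fun j => (hlead j).1) (fun j => (hlead j).2)
    (Fintype.card V - 1) ?_ ?_
  · intro j m hm
    obtain ⟨τ, -, rfl⟩ := pp_P_support K G _ _ m hm
    exact pp_deg_mon _ _
  intro m hm
  have hlt : ∀ j, ∃ z, m z < g j z := by
    intro j
    have := hm j
    rw [Finsupp.le_def] at this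
    push Not at this
    exact this
  have hT0 : ∀ a, ∃ c, c ≠ a ∧ m s(c, c) = 0 := by
    intro a
    obtain ⟨z, hz⟩ := hlt (jj a a (hrr a))
    by_cases hzd : z.IsDiag
    · induction z using Sym2.ind with
      | _ x y =>
        have hxy : x = y := hzd
        subst hxy
        rw [hdiag] at hz
        split_ifs at hz with h
        · exact ⟨x, h.1, by omega⟩
        · omega
    · rw [hoff a z hzd] at hz
      omega
  by_cases hnr : ∃ a b, a ≠ b ∧ m s(a, a) = 0 ∧ m s(b, b) = 0 ∧ ¬ T.Reachable a b
  · -- two vertices in different components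
    obtain ⟨a, b, hab, ha, hb, hr⟩ := hnr
    refine ⟨{s(a, a), s(b, b)}, fun z => if z = s(b, b) then jj a a (hrr a) else jj b b (hrr b),
      ?_, ?_, ?_, ?_⟩
    · simp [ha, hb]
    · simp [hss a b hab, hself a b hab.symm, hself b a hab]
    · simp [hss a b hab, hss b a hab.symm, hself0]
    · intro η h1 h2 h3 j
      have e1 := h3 s(a, a) (by simp)
      have e2 := h3 s(b, b) (by simp)
      simp only [hss a b hab, if_false, if_true] at e1 e2
      refine pp_van1 T G η a b hab ?_ e2 e1 ?_ _ _
      · intro i hia hib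
        apply h1
        simp [hia, hib]
      · rw [pp_P_not_reach K T G hTG a b hr, map_zero]
  push Not at hnr
  obtain ⟨b0, -, hb0⟩ := hT0 v0
  obtain ⟨a0, hab0, ha0⟩ := hT0 b0
  obtain ⟨⟨a, b⟩, hmem, hmax⟩ := Finset.exists_max_image
    (Finset.univ.filter fun q : V × V => q.1 ≠ q.2 ∧ m s(q.1, q.1) = 0 ∧ m s(q.2, q.2) = 0)
    (fun q => T.dist q.1 q.2) ⟨(a0, b0), by simp [hab0, ha0, hb0]⟩
  simp only [Finset.mem_filter, Finset.mem_univ, true_and] at hmem hmax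
  obtain ⟨hab, ha, hb⟩ := hmem
  have hr := hnr a b hab ha hb
  by_cases hc : ∃ c, c ≠ b ∧ m s(c, c) = 0 ∧ σ (jj a b hr) c = c
  · obtain ⟨c, hcb, hc0, hfc⟩ := hc
    have hca : a ≠ c := by
      rintro rfl
      exact hmove a b hr hab hfc
    have hrac := hnr a c hca ha hc0
    have hrbc := hnr b c hcb.symm hb hc0
    have d1 : T.dist a c ≤ T.dist a b := hmax (a, c) ⟨hca, ha, hc0⟩
    have d2 : T.dist b c ≤ T.dist b a := by
      rw [SimpleGraph.dist_comm (u := b) (v := a)]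
      exact hmax (b, c) ⟨hcb.symm, hb, hc0⟩
    have f1 : σ (jj a c hrac) b = b := hσf (jj a c hrac) b hcb.symm d1
    have f2 : σ (jj b c hrbc) a = a := hσf (jj b c hrbc) a hca d2
    have n1 := hss a b hab
    have n2 := hss a c hca
    have n3 := hss c b hcb
    refine ⟨{s(a, a), s(b, b), s(c, c)}, fun z => if z = s(c, c) then jj a b hr else
      if z = s(b, b) then jj a c hrac else jj b c hrbc, ?_, ?_, ?_, ?_⟩
    · simp [ha, hb, hc0]
    · simp [n1, n2, n3, n3.symm, hgc a b c hr hcb hfc, hgc a c b hrac hcb.symm f1,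
        hgc b c a hrbc hca f2]
    · simp [n1, n2, n3, n1.symm, n2.symm, n3.symm, hga a b hr hab, hgb, hga a c hrac hca,
        hga b c hrbc hcb.symm]
    · intro η h1 h2 h3 j
      have e1 := h3 s(a, a) (by simp)
      have e2 := h3 s(b, b) (by simp)
      have e3 := h3 s(c, c) (by simp)
      simp only [n1, n2, n3, n3.symm, if_false, if_true] at e1 e2 e3
      refine pp_van2 T G η a b c hab hca hcb.symm ?_ ?_ ?_ e3 e2 e1 _ _
      · intro i hia hib hic
        apply h1
        simp [hia, hib, hic]
      · intro h0
        have := pp_change T G η a c b hab 1 e2 h0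
        refine pp_eval_ne_zero (pp_c T) _ _ (hlead (jj a c hrac)).1 (hlead (jj a c hrac)).2
          (Function.update η s(b, b) 1) ?_ this
        intro z hz
        by_cases hzb : z = s(b, b)
        · subst hzb; simp
        · rw [Function.update_of_ne hzb]
          apply h1
          simp only [Finset.mem_insert, Finset.mem_singleton]
          rintro (rfl | rfl | rfl)
          · exact hz (hga a c hrac hca)
          · exact hzb rfl
          · exact hz (hgb a c hrac)
      · intro h0
        have := pp_change T G η a b c hca 1 e3 h0
        refine pp_eval_ne_zero (pp_c T) _ _ (hlead (jj a b hr)).1 (hlead (jj a b hr)).2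
          (Function.update η s(c, c) 1) ?_ this
        intro z hz
        by_cases hzb : z = s(c, c)
        · subst hzb; simp
        · rw [Function.update_of_ne hzb]
          apply h1
          simp only [Finset.mem_insert, Finset.mem_singleton]
          rintro (rfl | rfl | rfl)
          · exact hz (hga a b hr hab)
          · exact hz (hgb a b hr)
          · exact hzb rfl
  · push Not at hc
    obtain ⟨z, hz⟩ := hlt (jj a b hr)
    have hzd : ¬ z.IsDiag := by
      intro hzd
      induction z using Sym2.ind with
      | _ x y =>
        have hxy : x = y := hzd
        subst hxy
        rw [hdiag] at hz
        split_ifs at hz with h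
        · exact hc x h.1 (by omega) h.2
        · omega
    have hz1 : g (jj a b hr) z ≤ 1 := pp_mon_offdiag T a b _ (hσt (jj a b hr)) z hzd
    have hz2 : g (jj a b hr) z = 1 := by omega
    have hz3 : m z = 0 := by omega
    have hzs : ∀ i, z ≠ s(i, i) := by
      rintro i rfl
      exact hzd (Sym2.diag_isDiag i)
    have n1 := hss a b hab
    refine ⟨{s(a, a), s(b, b), z}, fun q => if q = s(b, b) then jj a a (hrr a) else
      if q = s(a, a) then jj b b (hrr b) else jj a b hr, ?_, ?_, ?_, ?_⟩
    · simp [ha, hb, hz3]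
    · simp [n1, hzs, hz2, hself a b hab.symm, hself b a hab]
    · simp [n1, n1.symm, hzs, (hzs _).symm, hself0, hoff _ z hzd, hgb, hga a b hr hab]
    · intro η h1 h2 h3 j
      have e1 := h3 s(a, a) (by simp)
      have e2 := h3 s(b, b) (by simp)
      have e3 := h3 z (by simp)
      simp only [n1, hzs, if_false, if_true] at e1 e2 e3
      refine pp_van1 T G η a b hab ?_ e2 e1 e3 _ _
      intro i hia hib
      apply h1
      simp [hia, hib, (hzs i).symm]

/-! ### The ideal of submaximal minors -/

lemma pp_minors {R : Type*} [CommRing R] {k : ℕ} (M : Matrix (Fin (k + 1)) (Fin (k + 1)) R) :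
    minorsIdeal k M = Ideal.span (Set.range fun ab : Fin (k + 1) × Fin (k + 1) =>
      (M.updateRow ab.1 (Pi.single ab.2 1)).det) := by
  have hfac : ∀ f : Fin k → Fin (k + 1), Function.Injective f →
      ∃ (a : Fin (k + 1)) (e : Equiv.Perm (Fin k)), f = a.succAbove ∘ e := by
    intro f hf
    have : ∃ a, ∀ i, f i ≠ a := by
      by_contra hcon
      push Not at hcon
      have := Fintype.card_le_of_surjective f hcon
      simp at this
    obtain ⟨a, ha⟩ := this
    choose e he using fun i => Fin.exists_succAbove_eq (ha i)
    have hinj : Function.Injective e := by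
      intro i j h
      apply hf
      rw [← he, ← he, h]
    exact ⟨a, Equiv.ofBijective e (Finite.injective_iff_bijective.mp hinj),
      funext fun i => (he i).symm⟩
  have hadj : ∀ a b, (M.updateRow a (Pi.single b 1)).det =
      (-1) ^ (a + b : ℕ) * (M.submatrix a.succAbove b.succAbove).det := by
    intro a b
    rw [← Matrix.adjugate_apply, Matrix.adjugate_fin_succ_eq_det_submatrix]
  apply le_antisymm
  · rw [minorsIdeal, Ideal.span_le]
    rintro _ ⟨f, f', hf, hf', rfl⟩
    obtain ⟨a, e, rfl⟩ := hfac f hf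
    obtain ⟨b, e', rfl⟩ := hfac f' hf'
    have h1 : (M.submatrix a.succAbove b.succAbove).det ∈ Ideal.span (Set.range
        fun ab : Fin (k + 1) × Fin (k + 1) => (M.updateRow ab.1 (Pi.single ab.2 1)).det) := by
      have h2 : (M.submatrix a.succAbove b.succAbove).det =
          (-1) ^ (a + b : ℕ) * (M.updateRow a (Pi.single b 1)).det := by
        rw [hadj, ← mul_assoc, ← pow_add, ← two_mul, pow_mul]
        simp
      rw [h2]
      exact Ideal.mul_mem_left _ _ (Ideal.subset_span ⟨(a, b), rfl⟩)
    have h3 : M.submatrix (a.succAbove ∘ e) (b.succAbove ∘ e') =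
        ((M.submatrix a.succAbove b.succAbove).submatrix e id).submatrix id e' := rfl
    rw [h3, Matrix.det_permute', Matrix.det_permute]
    exact Ideal.mul_mem_left _ _ (Ideal.mul_mem_left _ _ h1)
  · rw [Ideal.span_le]
    rintro _ ⟨⟨a, b⟩, rfl⟩
    simp only [hadj]
    exact Ideal.mul_mem_left _ _ (Ideal.subset_span
      ⟨_, _, Fin.succAbove_right_injective, Fin.succAbove_right_injective, rfl⟩)

/-- For every field `K`, every `n ≥ 2` and every simple graph `G` on `[n]`, the ideal
`I_{n-1}(X_G)` of submaximal minors of the sparse generic symmetric matrix `X_G` is radical. -/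
theorem submaximalMinors_sparse_symmetric_isRadical
    (K : Type*) [Field K] (n : ℕ) (hn : 2 ≤ n) (G : SimpleGraph (Fin n)) :
    (minorsIdeal (n - 1) (sparseGenericSym K n G)).IsRadical := by
  obtain ⟨k, rfl⟩ : ∃ k, n = k + 1 := ⟨n - 1, by omega⟩
  rw [Nat.add_sub_cancel, pp_minors]
  have h := pp_main K G
  have e : (fun ab : Fin (k + 1) × Fin (k + 1) =>
      ((sparseGenericSym K (k + 1) G).updateRow ab.1 (Pi.single ab.2 1)).det) =
      fun ab => pp_P K G ab.1 ab.2 := by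
    funext ab
    unfold pp_P
    have : sparseGenericSym K (k + 1) G = pp_X K G := by
      ext1 i j
      simp only [sparseGenericSym, pp_X]
      congr
    rw [this]
    congr!
  rw [e]
  exact h
end

section
/- The height of the ideal I_{n-1}(X_G) ⊆ R equals 3 if the graph G is connected (as a graph on the vertex set [n]), and equals 2 if G is disconnected. -/
open MvPolynomial
open scoped Classical

/-- The height of an ideal `I` in a commutative ring: the infimum, over all prime ideals
`p` containing `I`, of the height of `p` (the height of a prime being the supremum of the
lengths of chains of primes descending from it, i.e. its height as a point of the prime
spectrum ordered by inclusion). -/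
noncomputable def idealHeight {R : Type*} [CommRing R] (I : Ideal R) : ℕ∞ :=
  ⨅ p ∈ {p : PrimeSpectrum R | I ≤ p.asIdeal}, Order.height p


section Aux

/-- Elimination of one variable: a prime `q ≤ p` generated by the part of `p` free of `X i`. -/
theorem aux_elim {σ K : Type*} [Field K] (p : Ideal (MvPolynomial σ K)) [p.IsPrime] (i : σ) :
    ∃ q : Ideal (MvPolynomial σ K), q.IsPrime ∧ q ≤ p ∧
      (∀ f ∈ supported K ({i}ᶜ : Set σ), f ∈ p → f ∈ q) ∧
      (∀ d ∈ supported K ({i}ᶜ : Set σ), ∀ g ∈ supported K ({i}ᶜ : Set σ), d ∉ p →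
        X i * d + g ∉ q) := by
  let A := MvPolynomial σ K ⧸ p
  let φ : MvPolynomial σ K →ₐ[K] Polynomial A :=
    aeval (fun j => if j = i then Polynomial.X else Polynomial.C (Ideal.Quotient.mk p (X j)))
  let ψ : MvPolynomial σ K →ₐ[K] Polynomial A :=
    (Polynomial.CAlgHom).comp (Ideal.Quotient.mkₐ K p)
  have hψ : ∀ f, ψ f = Polynomial.C (Ideal.Quotient.mk p f) := fun f => rfl
  have hfree : ∀ f ∈ supported K ({i}ᶜ : Set σ), φ f = ψ f := by
    intro f hf
    have : supported K ({i}ᶜ : Set σ) ≤ AlgHom.equalizer φ ψ := by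
      rw [supported_eq_adjoin_X, Algebra.adjoin_le_iff]
      rintro _ ⟨j, hj, rfl⟩
      have hj' : j ≠ i := hj
      change φ (X j) = ψ (X j)
      simp [φ, hψ, hj']
    exact this hf
  refine ⟨RingHom.ker φ, RingHom.ker_isPrime φ, ?_, ?_, ?_⟩
  · intro f hf
    have h1 : (Polynomial.evalRingHom (Ideal.Quotient.mk p (X i))).comp φ.toRingHom
        = Ideal.Quotient.mk p := by
      apply MvPolynomial.ringHom_ext
      · intro r
        simp only [φ, RingHom.comp_apply]
        change Polynomial.eval _ (aeval _ (C r)) = _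
        rw [← MvPolynomial.algebraMap_eq, AlgHom.commutes,
          IsScalarTower.algebraMap_apply K A (Polynomial A)]
        simp
        rfl
      · intro j
        simp only [φ, RingHom.comp_apply]
        change Polynomial.eval _ (aeval _ (X j)) = _
        by_cases hj : j = i
        · subst hj; simp
        · simp [hj]
    rw [RingHom.mem_ker] at hf
    have h2 := congrArg (fun g => g f) h1
    simp only [RingHom.comp_apply] at h2
    rw [← Ideal.Quotient.eq_zero_iff_mem, ← h2]
    change Polynomial.eval _ (φ f) = 0
    rw [hf]; simp
  · intro f hf hfp
    rw [RingHom.mem_ker, hfree f hf, hψ, Ideal.Quotient.eq_zero_iff_mem.mpr hfp]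
    simp
  · intro d hd g hg hdp h
    rw [RingHom.mem_ker, map_add, map_mul, hfree d hd, hfree g hg, hψ, hψ] at h
    have hX : φ (X i) = Polynomial.X := by simp [φ]
    rw [hX] at h
    have := congrArg (fun r => Polynomial.coeff r 1) h
    simp [Polynomial.coeff_C] at this
    exact hdp (Ideal.Quotient.eq_zero_iff_mem.mp this)

theorem aux_det_mem {R A : Type*} [CommRing R] [CommRing A] [Algebra R A] (S : Subalgebra R A)
    {k : ℕ} (N : Matrix (Fin k) (Fin k) A) (h : ∀ i j, N i j ∈ S) : N.det ∈ S := by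
  rw [Matrix.det_apply]
  refine S.sum_mem fun σ _ => ?_
  rcases Int.units_eq_one_or (Equiv.Perm.sign σ) with h1 | h1 <;> rw [h1]
  · simpa using S.prod_mem fun i _ => h _ _
  · simpa using S.prod_mem fun i _ => h _ _

universe uK
variable {K : Type uK} [Field K] {n : ℕ} {G : SimpleGraph (Fin n)}

theorem aux_entry (u i j : Fin n) (h : ¬ (i = u ∧ j = u)) :
    sparseGenericSym K n G i j ∈ supported K ({s(u, u)}ᶜ : Set (Sym2 (Fin n))) := by
  unfold sparseGenericSym
  split_ifs with h1
  · rw [X_mem_supported]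
    intro h2
    apply h
    simpa using h2
  · exact Subalgebra.zero_mem _

theorem aux_minor {k : ℕ} (u : Fin n) (f g : Fin k → Fin n)
    (h : ∀ i j, ¬ (f i = u ∧ g j = u)) :
    ((sparseGenericSym K n G).submatrix f g).det ∈
      supported K ({s(u, u)}ᶜ : Set (Sym2 (Fin n))) :=
  aux_det_mem _ _ fun i j => aux_entry u _ _ (h i j)

theorem aux_step {k : ℕ} (u : Fin n) (f : Fin k → Fin n) (hu : ∀ i, f i ≠ u)
    (p : PrimeSpectrum (SymPolyRing K n))
    (hd : ((sparseGenericSym K n G).submatrix f f).det ∉ p.asIdeal)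
    (hm : ((sparseGenericSym K n G).submatrix (Fin.cons u f : Fin (k+1) → Fin n)
      (Fin.cons u f : Fin (k+1) → Fin n)).det ∈ p.asIdeal) :
    ∃ q : PrimeSpectrum (SymPolyRing K n), q < p ∧
      (∀ f ∈ supported K ({s(u, u)}ᶜ : Set (Sym2 (Fin n))), f ∈ p.asIdeal → f ∈ q.asIdeal) := by
  obtain ⟨q, hq, hqp, h1, h2⟩ := aux_elim p.asIdeal s(u, u)
  refine ⟨⟨q, hq⟩, ?_, h1⟩
  refine lt_of_le_of_ne hqp ?_
  intro h
  rw [← h] at hm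
  rw [Matrix.det_succ_row_zero, Fin.sum_univ_succ] at hm
  have e0 : ((sparseGenericSym K n G).submatrix (Fin.cons u f : Fin (k+1) → Fin n)
      (Fin.cons u f : Fin (k+1) → Fin n)) 0 0 = X s(u, u) := by
    simp [sparseGenericSym]
  have e1 : (((sparseGenericSym K n G).submatrix (Fin.cons u f : Fin (k+1) → Fin n)
      (Fin.cons u f : Fin (k+1) → Fin n)).submatrix Fin.succ (Fin.succAbove 0)) =
      (sparseGenericSym K n G).submatrix f f := by
    ext i j; simp
  rw [e0, e1] at hm
  simp only [Fin.val_zero, pow_zero, one_mul] at hm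
  refine h2 _ (aux_minor u f f fun i j hij => hu i hij.1) _ ?_ hd hm
  refine Subalgebra.sum_mem _ fun j _ => ?_
  refine Subalgebra.mul_mem _ (Subalgebra.mul_mem _ ?_ ?_) ?_
  · exact Subalgebra.pow_mem _ (Subalgebra.neg_mem _ (Subalgebra.one_mem _)) _
  · simp only [Matrix.submatrix_apply, Fin.cons_zero, Fin.cons_succ]
    exact aux_entry _ _ _ fun h => hu _ h.2
  · rw [Matrix.submatrix_submatrix]
    exact aux_minor _ _ _ fun i j h => hu i (by simpa using h.1)

theorem aux_cons_inj {k : ℕ} (u : Fin n) (f : Fin k → Fin n) (hu : ∀ i, f i ≠ u)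
    (hf : Function.Injective f) : Function.Injective (Fin.cons u f : Fin (k+1) → Fin n) := by
  rw [Fin.cons_injective_iff]
  exact ⟨fun ⟨i, hi⟩ => hu i hi, hf⟩

theorem aux_cons_ne {k : ℕ} (u w : Fin n) (f : Fin k → Fin n) (hw : ∀ i, f i ≠ w) (huw : u ≠ w) :
    ∀ i, (Fin.cons u f : Fin (k+1) → Fin n) i ≠ w := by
  intro i
  refine Fin.cases ?_ (fun j => ?_) i
  · simpa using huw
  · simpa using hw j

/-- Nonvanishing of the off-diagonal minor for a connected graph. -/
theorem aux_nonzero {k : ℕ} (hG : G.Connected) (u w : Fin n) (f : Fin k → Fin n)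
    (hf : Function.Injective f) (huw : u ≠ w) (hu : ∀ i, f i ≠ u) (hw : ∀ i, f i ≠ w)
    (hall : ∀ x, x = u ∨ x = w ∨ ∃ i, f i = x) :
    ((sparseGenericSym K n G).submatrix (Fin.cons u f : Fin (k+1) → Fin n)
      (Fin.cons w f : Fin (k+1) → Fin n)).det ≠ 0 := by
  obtain ⟨P, hP⟩ := hG.exists_isPath u w
  let val : Sym2 (Fin n) → K := fun e =>
    if (∃ i < P.length, e = s(P.getVert i, P.getVert (i+1))) ∨ (∃ a, a ∉ P.support ∧ e = s(a, a))
    then 1 else 0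
  let E : Matrix (Fin n) (Fin n) K := (sparseGenericSym K n G).map (MvPolynomial.eval val)
  have hE : ∀ i j, E i j = if (∃ a < P.length, s(i, j) = s(P.getVert a, P.getVert (a+1))) ∨
      (∃ a, a ∉ P.support ∧ s(i, j) = s(a, a)) then 1 else 0 := by
    intro i j
    simp only [E, Matrix.map_apply, sparseGenericSym]
    by_cases h : i = j ∨ G.Adj i j
    · simp only [if_pos h, MvPolynomial.eval_X, val]
    · rw [if_neg h, map_zero, if_neg]
      rintro (⟨a, ha, h1⟩ | ⟨a, ha, h1⟩)
      · have := P.adj_getVert_succ ha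
        rw [← SimpleGraph.mem_edgeSet, ← h1, SimpleGraph.mem_edgeSet] at this
        exact h (Or.inr this)
      · rw [Sym2.eq_iff] at h1
        apply h; left; grind
  intro h0
  have h1 : (E.submatrix (Fin.cons u f : Fin (k+1) → Fin n)
      (Fin.cons w f : Fin (k+1) → Fin n)).det = 0 := by
    have := congrArg (MvPolynomial.eval val) h0
    rw [RingHom.map_det, map_zero] at this
    exact this
  obtain ⟨y, hy, hEy⟩ := Matrix.exists_mulVec_eq_zero_iff.mpr h1
  have hcw := aux_cons_inj w f hw hf
  let c : Fin (k+1) → Fin n := Fin.cons w f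
  have hc : Function.Injective c := hcw
  let v : Fin n → K := Function.extend c y 0
  have hvc : ∀ j, v (c j) = y j := fun j => hc.extend_apply _ _ _
  have hvu : v u = 0 := by
    apply Function.extend_apply'
    rintro ⟨a, ha⟩
    exact aux_cons_ne w u f hu huw.symm a ha
  have hrow : ∀ r, r ≠ w → ∑ x, E r x * v x = 0 := by
    intro r hr
    obtain ⟨i, hi⟩ : ∃ i, (Fin.cons u f : Fin (k+1) → Fin n) i = r := by
      rcases hall r with h | h | ⟨i, h⟩
      · exact ⟨0, by simp [h]⟩
      · exact absurd h hr
      · exact ⟨i.succ, by simpa using h⟩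
    have h2 := congrFun hEy i
    simp only [Matrix.mulVec, dotProduct, Matrix.submatrix_apply, hi, Pi.zero_apply] at h2
    rw [← h2]
    symm
    refine Fintype.sum_of_injective c hc _ _ ?_ ?_
    · intro x hx
      have : v x = 0 := Function.extend_apply' _ _ _ (fun ⟨a, ha⟩ => hx ⟨a, ha⟩)
      rw [this, mul_zero]
    · intro j
      rw [hvc]
  have hpath : ∀ i, i ≤ P.length → ∀ j ≤ i, v (P.getVert j) = 0 := by
    intro i
    induction i with
    | zero =>
      intro _ j hj
      obtain rfl : j = 0 := by omega
      simpa using hvu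
    | succ i ih =>
      intro hi j hj
      rcases Nat.lt_or_ge j (i+1) with h | h
      · exact ih (by omega) j (by omega)
      obtain rfl : j = i + 1 := by omega
      have hne : P.getVert i ≠ w := by
        intro h
        have h3 : P.getVert i = P.getVert P.length := by rw [h, P.getVert_length]
        have := hP.getVert_injOn (by simp; omega) (by simp) h3
        omega
      have hs := hrow _ hne
      rw [Finset.sum_eq_single (P.getVert (i+1))] at hs
      · rw [hE, if_pos (Or.inl ⟨i, by omega, rfl⟩), one_mul] at hs
        exact hs
      · intro x _ hx
        rw [hE]
        split_ifs with h4
        · rw [one_mul]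
          rcases h4 with ⟨a, ha, h4⟩ | ⟨a, ha, h4⟩
          · rw [Sym2.eq_iff] at h4
            rcases h4 with ⟨h5, h6⟩ | ⟨h5, h6⟩
            · have := hP.getVert_injOn (by simp; omega) (by simp; omega) h5
              subst this
              exact absurd h6 hx
            · have := hP.getVert_injOn (by simp; omega) (by simp; omega) h5
              rw [h6]
              exact ih (by omega) a (by omega)
          · exfalso
            rw [Sym2.eq_iff] at h4
            have : P.getVert i = a := by grind
            exact ha (this ▸ P.getVert_mem_support i)
        · rw [zero_mul]
      · simp
  have hv : ∀ x, v x = 0 := by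
    intro x
    by_cases hx : x ∈ P.support
    · obtain ⟨i, hi, hi'⟩ := SimpleGraph.Walk.mem_support_iff_exists_getVert.mp hx
      rw [← hi]
      exact hpath i hi' i le_rfl
    · have hxw : x ≠ w := by
        rintro rfl
        exact hx P.end_mem_support
      have hs := hrow x hxw
      rw [Finset.sum_eq_single x] at hs
      · rw [hE, if_pos (Or.inr ⟨x, hx, rfl⟩), one_mul] at hs
        exact hs
      · intro z _ hz
        rw [hE, if_neg, zero_mul]
        rintro (⟨a, ha, h4⟩ | ⟨a, ha, h4⟩)
        · rw [Sym2.eq_iff] at h4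
          have h5 := P.getVert_mem_support a
          have h6 := P.getVert_mem_support (a+1)
          grind
        · rw [Sym2.eq_iff] at h4
          grind
      · simp
  apply hy
  funext j
  rw [← hvc, hv]; rfl

theorem aux_two_le (p q r : PrimeSpectrum (SymPolyRing K n)) (h1 : q < p) (h2 : r < q) :
    2 ≤ Order.height p := by
  have a1 := Order.height_add_one_le h1
  have a2 := Order.height_add_one_le h2
  calc (2 : ℕ∞) = 0 + 1 + 1 := by norm_num
    _ ≤ Order.height r + 1 + 1 := by gcongr; exact zero_le
    _ ≤ Order.height q + 1 := by gcongr
    _ ≤ _ := a1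

theorem aux_three_le (p q r t : PrimeSpectrum (SymPolyRing K n)) (h1 : q < p) (h2 : r < q)
    (h3 : t < r) : 3 ≤ Order.height p := by
  have a1 := Order.height_add_one_le h1
  have a2 := aux_two_le _ _ _ h2 h3
  calc (3 : ℕ∞) = 2 + 1 := by norm_num
    _ ≤ Order.height q + 1 := by gcongr
    _ ≤ _ := a1

theorem aux_lower {m : ℕ} (G : SimpleGraph (Fin (m+2)))
    (p : PrimeSpectrum (SymPolyRing K (m+2)))
    (hp : minorsIdeal (m+1) (sparseGenericSym K (m+2) G) ≤ p.asIdeal) :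
    2 ≤ Order.height p ∧ (G.Connected → 3 ≤ Order.height p) := by
  let M := sparseGenericSym K (m+2) G
  let Q : ℕ → Prop := fun k => ∃ f : Fin k → Fin (m+2), Function.Injective f ∧
    (M.submatrix f f).det ∉ p.asIdeal
  have hQ0 : Q 0 := ⟨Fin.elim0, fun i => i.elim0, by
    rw [Matrix.det_isEmpty]
    exact fun h => p.2.ne_top ((Ideal.eq_top_iff_one _).mpr h)⟩
  have hI : ∀ f g : Fin (m+1) → Fin (m+2), Function.Injective f → Function.Injective g →
      (M.submatrix f g).det ∈ p.asIdeal := fun f g hf hg =>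
    hp (Ideal.subset_span ⟨f, g, hf, hg, rfl⟩)
  obtain ⟨k, hk⟩ : ∃ k, k = Nat.findGreatest Q m := ⟨_, rfl⟩
  have hkm : k ≤ m := hk ▸ Nat.findGreatest_le m
  have hQk : Q k := by
    rw [hk]; exact Nat.findGreatest_spec (Nat.zero_le m) hQ0
  have hnext : ∀ g : Fin (k+1) → Fin (m+2), Function.Injective g →
      (M.submatrix g g).det ∈ p.asIdeal := by
    intro g hg
    rcases Nat.lt_or_ge k m with h | h
    · by_contra hc
      exact Nat.findGreatest_is_greatest (P := Q) (n := m) (k := k+1) (by omega) (by omega)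
        ⟨g, hg, hc⟩
    · obtain rfl : k = m := le_antisymm hkm h
      exact hI g g hg hg
  obtain ⟨f, hf, hd⟩ := hQk
  let Cc : Finset (Fin (m+2)) := (Finset.univ.image f)ᶜ
  have hmem : ∀ x, x ∈ Cc ↔ ∀ i, f i ≠ x := by
    intro x; simp [Cc]
  have hcard : Cc.card = m + 2 - k := by
    rw [Finset.card_compl, Finset.card_image_of_injective _ hf]; simp
  rcases Nat.lt_or_ge k m with hlt | hge
  · obtain ⟨a, ha, b, hb, c, hc, hab, hac, hbc⟩ := Finset.two_lt_card.mp (by omega : 2 < Cc.card)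
    rw [hmem] at ha hb hc
    obtain ⟨q, hq, hqs⟩ := aux_step a f ha p hd (hnext _ (aux_cons_inj a f ha hf))
    obtain ⟨r, hr, hrs⟩ := aux_step b f hb q (fun h => hd (hq.le h))
      (hqs _ (aux_minor a _ _ fun i j h => aux_cons_ne b a f ha hab.symm i h.1)
        (hnext _ (aux_cons_inj b f hb hf)))
    obtain ⟨t, ht, -⟩ := aux_step c f hc r (fun h => hd (hq.le (hr.le h)))
      (hrs _ (aux_minor b _ _ fun i j h => aux_cons_ne c b f hb hbc.symm i h.1)
        (hqs _ (aux_minor a _ _ fun i j h => aux_cons_ne c a f ha hac.symm i h.1)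
          (hnext _ (aux_cons_inj c f hc hf))))
    exact ⟨aux_two_le _ _ _ hq hr, fun _ => aux_three_le _ _ _ _ hq hr ht⟩
  · obtain rfl : k = m := le_antisymm hkm hge
    obtain ⟨a, ha, b, hb, hab⟩ := Finset.one_lt_card.mp (by omega : 1 < Cc.card)
    have hCc : Cc = {a, b} := by
      symm
      apply Finset.eq_of_subset_of_card_le
      · intro x hx
        simp only [Finset.mem_insert, Finset.mem_singleton] at hx
        rcases hx with rfl | rfl <;> assumption
      · rw [hcard, Finset.card_pair hab]; omega
    rw [hmem] at ha hb
    obtain ⟨q, hq, hqs⟩ := aux_step a f ha p hd (hnext _ (aux_cons_inj a f ha hf))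
    obtain ⟨r, hr, hrs⟩ := aux_step b f hb q (fun h => hd (hq.le h))
      (hqs _ (aux_minor a _ _ fun i j h => aux_cons_ne b a f ha hab.symm i h.1)
        (hnext _ (aux_cons_inj b f hb hf)))
    refine ⟨aux_two_le _ _ _ hq hr, fun hG => ?_⟩
    have hne := aux_nonzero (K := K) hG a b f hf hab ha hb (by
      intro x
      by_cases hx : x ∈ Cc
      · rw [hCc] at hx
        simp only [Finset.mem_insert, Finset.mem_singleton] at hx
        tauto
      · rw [hmem] at hx
        push Not at hx
        tauto)
    have hfr := hrs _ (aux_minor b _ _ fun i j h => aux_cons_ne a b f hb hab i h.1)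
      (hqs _ (aux_minor a _ _ fun i j h => aux_cons_ne b a f ha hab.symm j h.2)
        (hI _ _ (aux_cons_inj a f ha hf) (aux_cons_inj b f hb hf)))
    refine aux_three_le p q r ⟨⊥, Ideal.isPrime_bot⟩ hq hr ?_
    refine lt_of_le_of_ne (fun x hx => ?_) ?_
    · have hx' : x = 0 := hx
      rw [hx']; exact r.asIdeal.zero_mem
    · intro h
      rw [← h] at hfr
      exact hne hfr

/-- If the kernel contains, for each coordinate, a nonzero vector vanishing there, then all
submaximal minors vanish. -/
theorem aux_minor_zero {F : Type*} [Field F] {m : ℕ} (N : Matrix (Fin (m+2)) (Fin (m+2)) F)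
    (h : ∀ c, ∃ v : Fin (m+2) → F, v ≠ 0 ∧ N.mulVec v = 0 ∧ v c = 0)
    (f g : Fin (m+1) → Fin (m+2)) (hg : Function.Injective g) :
    (N.submatrix f g).det = 0 := by
  have hcard : ((Finset.univ.image g)ᶜ : Finset (Fin (m+2))).card = 1 := by
    rw [Finset.card_compl, Finset.card_image_of_injective _ hg]; simp
  obtain ⟨c, hc⟩ := Finset.card_eq_one.mp hcard
  have hc' : ∀ x, x ∉ Set.range g → x = c := by
    intro x hx
    have : x ∈ ((Finset.univ.image g)ᶜ : Finset (Fin (m+2))) := by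
      simpa using hx
    rw [hc] at this
    simpa using this
  obtain ⟨v, hv, hNv, hvc⟩ := h c
  refine Matrix.exists_mulVec_eq_zero_iff.mp ⟨v ∘ g, ?_, ?_⟩
  · intro h0
    apply hv
    funext x
    by_cases hx : x ∈ Set.range g
    · obtain ⟨j, rfl⟩ := hx
      exact congrFun h0 j
    · rw [hc' x hx, hvc]; rfl
  · funext i
    have h1 := congrFun hNv (f i)
    simp only [Matrix.mulVec, dotProduct, Pi.zero_apply] at h1
    simp only [Matrix.mulVec, dotProduct, Pi.zero_apply, Matrix.submatrix_apply,
      Function.comp_apply]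
    rw [← h1]
    refine Fintype.sum_of_injective g hg _ _ ?_ (fun _ => rfl)
    intro x hx
    rw [hc' x hx, hvc, mul_zero]

/-- Upper bound for heights from Krull's theorem. -/
theorem aux_upper {m : ℕ} (M : Matrix (Fin (m+2)) (Fin (m+2)) (SymPolyRing K (m+2)))
    (φ : SymPolyRing K (m+2) →+* K) (s : Finset (SymPolyRing K (m+2))) (N : ℕ) (hs : s.card ≤ N)
    (hφ : ∀ x ∈ s, φ x = 0)
    (hmain : ∀ (F : Type uK) [Field F] (ψ : SymPolyRing K (m+2) →+* F), (∀ x ∈ s, ψ x = 0) →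
      (∀ x, ψ x = 0 → φ x = 0) →
      ∀ c, ∃ v : Fin (m+2) → F, v ≠ 0 ∧ (M.map ψ).mulVec v = 0 ∧ v c = 0) :
    idealHeight (minorsIdeal (m+1) M) ≤ N := by
  have hle : Ideal.span (s : Set (SymPolyRing K (m+2))) ≤ RingHom.ker φ := by
    rw [Ideal.span_le]; intro x hx; exact hφ x hx
  have : (RingHom.ker φ).IsPrime := RingHom.ker_isPrime φ
  obtain ⟨p, hp, hpφ⟩ := Ideal.exists_minimalPrimes_le hle
  have hht := Ideal.height_le_card_of_mem_minimalPrimes_span_finset hp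
  have : p.IsPrime := hp.1.1
  let P : PrimeSpectrum (SymPolyRing K (m+2)) := ⟨p, hp.1.1⟩
  have hP : Order.height P = p.height := (PrimeSpectrum.height_eq_orderHeight P).symm
  have hIp : minorsIdeal (m+1) M ≤ p := by
    let ψ : SymPolyRing K (m+2) →+* FractionRing (SymPolyRing K (m+2) ⧸ p) :=
      (algebraMap _ _).comp (Ideal.Quotient.mk p)
    have hψ : ∀ x, ψ x = 0 ↔ x ∈ p := by
      intro x
      simp only [ψ, RingHom.comp_apply]
      rw [map_eq_zero_iff _ (IsFractionRing.injective _ _), Ideal.Quotient.eq_zero_iff_mem]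
    have hk := hmain _ ψ (fun x hx => (hψ x).mpr (hp.1.2 (Ideal.subset_span hx)))
      (fun x hx => hpφ ((hψ x).mp hx))
    unfold minorsIdeal
    rw [Ideal.span_le]
    rintro _ ⟨f, g, hf, hg, rfl⟩
    change _ ∈ p
    rw [← hψ, RingHom.map_det]
    exact aux_minor_zero _ hk f g hg
  unfold idealHeight
  refine (iInf₂_le P hIp).trans ?_
  rw [hP]
  exact hht.trans (by exact_mod_cast hs)

theorem aux_upper_two {m : ℕ} (G : SimpleGraph (Fin (m+2))) (hG : ¬ G.Connected) :
    idealHeight (minorsIdeal (m+1) (sparseGenericSym K (m+2) G)) ≤ 2 := by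
  obtain ⟨a, b, hab⟩ : ∃ a b, ¬ G.Reachable a b := by
    by_contra h
    push Not at h
    exact hG ⟨h⟩
  let S : Set (Fin (m+2)) := {x | G.Reachable a x}
  have haS : a ∈ S := SimpleGraph.Reachable.refl a
  have hS : ∀ i j, i ∈ S → j ∉ S → sparseGenericSym K (m+2) G i j = 0 ∧
      sparseGenericSym K (m+2) G j i = 0 := by
    intro i j hi hj
    have h1 : i ≠ j := by rintro rfl; exact hj hi
    have h2 : ¬ G.Adj i j := fun h => hj (SimpleGraph.Reachable.trans hi h.reachable)
    have h3 : ¬ G.Adj j i := fun h => h2 h.symm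
    simp [sparseGenericSym, h1, h1.symm, h2, h3]
  let A : Set (Fin (m+2)) → Matrix (Fin (m+2)) (Fin (m+2)) (SymPolyRing K (m+2)) := fun T i j =>
    if i ∈ T then sparseGenericSym K (m+2) G i j else if i = j then 1 else 0
  have hA1 : ∀ T i j, i ∈ T → A T i j = sparseGenericSym K (m+2) G i j :=
    fun T i j hi => if_pos hi
  have hA2 : ∀ T i j, i ∉ T → A T i j = if i = j then 1 else 0 := fun T i j hi => if_neg hi
  have key : ∀ (F : Type uK) [Field F] (ψ : SymPolyRing K (m+2) →+* F) (T : Set (Fin (m+2))),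
      (∀ i j, i ∉ T → j ∈ T → sparseGenericSym K (m+2) G i j = 0) → ψ (A T).det = 0 →
      ∃ v : Fin (m+2) → F, v ≠ 0 ∧ ((sparseGenericSym K (m+2) G).map ψ).mulVec v = 0 ∧
        ∀ c, c ∉ T → v c = 0 := by
    intro F _ ψ T hT h0
    rw [RingHom.map_det] at h0
    obtain ⟨v, hv, hAv⟩ := Matrix.exists_mulVec_eq_zero_iff.mpr h0
    have hvT : ∀ c, c ∉ T → v c = 0 := by
      intro c hc
      have := congrFun hAv c
      simpa [Matrix.mulVec, dotProduct, hA2 T c _ hc, apply_ite ψ] using this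
    refine ⟨v, hv, ?_, hvT⟩
    funext i
    by_cases hi : i ∈ T
    · have := congrFun hAv i
      simpa [Matrix.mulVec, dotProduct, hA1 T i _ hi] using this
    · simp only [Matrix.mulVec, dotProduct, Pi.zero_apply, Matrix.map_apply]
      refine Finset.sum_eq_zero fun j _ => ?_
      by_cases hj : j ∈ T
      · rw [hT i j hi hj]; simp
      · rw [hvT j hj, mul_zero]
  have hev : ∀ (T : Set (Fin (m+2))) (x : Fin (m+2)), x ∈ T →
      (constantCoeff : SymPolyRing K (m+2) →+* K) (A T).det = 0 := by
    intro T x hx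
    rw [RingHom.map_det]
    apply Matrix.det_eq_zero_of_row_eq_zero x
    intro j
    rw [RingHom.mapMatrix_apply, Matrix.map_apply, hA1 T x j hx]
    unfold sparseGenericSym
    split_ifs <;> simp
  refine aux_upper (K := K) (sparseGenericSym K (m+2) G) constantCoeff
    {(A S).det, (A Sᶜ).det} 2 Finset.card_le_two ?_ ?_
  · intro x hx
    simp only [Finset.mem_insert, Finset.mem_singleton] at hx
    rcases hx with rfl | rfl
    · exact hev S a haS
    · exact hev Sᶜ b hab
  · intro F _ ψ hψ _ c
    by_cases hc : c ∈ S
    · obtain ⟨v, h1, h2, h3⟩ := key F ψ Sᶜ (fun i j hi hj => (hS i j (not_not.mp hi) hj).1)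
        (hψ _ (by simp))
      exact ⟨v, h1, h2, h3 c (not_not.mpr hc)⟩
    · obtain ⟨v, h1, h2, h3⟩ := key F ψ S (fun i j hi hj => (hS j i hj hi).2)
        (hψ _ (by simp))
      exact ⟨v, h1, h2, h3 c hc⟩

/-- Bordered minors vanish implies that the bordered row is orthogonal to the solution `z`. -/
theorem aux_border {F : Type*} [Field F] {l m : ℕ} (N : Matrix (Fin l) (Fin l) F)
    (f : Fin m → Fin l) (r u : Fin l) (hd : (N.submatrix f f).det ≠ 0) (z : Fin m → F)
    (hz : ∀ i, N (f i) u + ∑ j, N (f i) (f j) * z j = 0)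
    (h0 : (N.submatrix (Fin.cons r f : Fin (m+1) → Fin l)
      (Fin.cons u f : Fin (m+1) → Fin l)).det = 0) :
    N r u + ∑ j, N r (f j) * z j = 0 := by
  obtain ⟨y, hy, hNy⟩ := Matrix.exists_mulVec_eq_zero_iff.mpr h0
  have hr : N r u * y 0 + ∑ j : Fin m, N r (f j) * y j.succ = 0 := by
    have := congrFun hNy 0
    simpa [Matrix.mulVec, dotProduct, Fin.sum_univ_succ] using this
  have hi : ∀ i, N (f i) u * y 0 + ∑ j : Fin m, N (f i) (f j) * y j.succ = 0 := by
    intro i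
    have := congrFun hNy i.succ
    simpa [Matrix.mulVec, dotProduct, Fin.sum_univ_succ] using this
  have hw : ∀ j : Fin m, y j.succ = y 0 * z j := by
    have hk : (N.submatrix f f).mulVec (fun j : Fin m => y j.succ - y 0 * z j) = 0 := by
      funext i
      simp only [Matrix.mulVec, dotProduct, Matrix.submatrix_apply, Pi.zero_apply, mul_sub,
        Finset.sum_sub_distrib]
      have e : ∑ j, N (f i) (f j) * (y 0 * z j) = y 0 * ∑ j, N (f i) (f j) * z j := by
        rw [Finset.mul_sum]; exact Finset.sum_congr rfl fun j _ => by ring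
      rw [e]
      linear_combination hi i - y 0 * hz i
    have := Matrix.eq_zero_of_mulVec_eq_zero hd hk
    intro j
    exact sub_eq_zero.mp (congrFun this j)
  have hy0 : y 0 ≠ 0 := by
    intro h
    apply hy
    funext j
    refine Fin.cases h (fun j => ?_) j
    rw [hw, h, zero_mul]; rfl
  apply mul_left_cancel₀ hy0
  rw [mul_zero, ← hr, mul_add, Finset.mul_sum, mul_comm]
  congr 1
  exact Finset.sum_congr rfl fun j _ => by rw [hw]; ring

theorem aux_upper_three {m : ℕ} (G : SimpleGraph (Fin (m+2))) :
    idealHeight (minorsIdeal (m+1) (sparseGenericSym K (m+2) G)) ≤ 3 := by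
  let M := sparseGenericSym K (m+2) G
  have hsymm : ∀ i j, M i j = M j i := by
    intro i j
    simp only [M, sparseGenericSym, Sym2.eq_swap (a := i), G.adj_comm i, eq_comm (a := i)]
  let f : Fin m → Fin (m+2) := fun i => i.succ.succ
  let D : Fin (m+2) → Fin (m+2) → SymPolyRing K (m+2) := fun r u =>
    (M.submatrix (Fin.cons r f : Fin (m+1) → Fin (m+2)) (Fin.cons u f : Fin (m+1) → Fin (m+2))).det
  have hDs : D 1 0 = D 0 1 := by
    simp only [D]
    rw [← Matrix.det_transpose]
    congr 1
    ext1 i j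
    simp only [Matrix.transpose_apply, Matrix.submatrix_apply]
    exact hsymm _ _
  let val : Sym2 (Fin (m+2)) → K := fun e => if ∃ i, e = s(f i, f i) then 1 else 0
  let φ : SymPolyRing K (m+2) →+* K := MvPolynomial.eval val
  have hφM : ∀ i j, φ (M i j) = if i = j ∧ ∃ a, i = f a then 1 else 0 := by
    intro i j
    by_cases hij : i = j
    · subst hij
      simp [φ, M, sparseGenericSym, val]
    · have : ¬ ∃ a, s(i, j) = s(f a, f a) := by
        rintro ⟨a, ha⟩
        rw [Sym2.eq_iff] at ha
        grind
      simp only [φ, M, sparseGenericSym]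
      split_ifs with h1 h2 h3
      · exact absurd h2.1 hij
      · simp only [MvPolynomial.eval_X, val, if_neg this]
      · exact absurd h3.1 hij
      · simp
  have hf0 : ∀ a, f a ≠ 0 := fun a => Fin.succ_ne_zero _
  have hf1 : ∀ a, f a ≠ 1 := by
    intro a h
    have := congrArg Fin.val h
    simp [f] at this
  have hD0 : ∀ r u, (∀ a, f a ≠ r) → φ (D r u) = 0 := by
    intro r u hr
    simp only [D]
    rw [RingHom.map_det]
    apply Matrix.det_eq_zero_of_row_eq_zero 0
    intro j
    simp only [RingHom.mapMatrix_apply, Matrix.map_apply, Matrix.submatrix_apply, Fin.cons_zero,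
      hφM]
    rw [if_neg]
    rintro ⟨-, a, ha⟩
    exact hr a ha.symm
  have hfinj : Function.Injective f := fun a b h => by simpa [f] using h
  have hδ : φ (M.submatrix f f).det = 1 := by
    rw [RingHom.map_det]
    have : φ.mapMatrix (M.submatrix f f) = 1 := by
      ext i j
      simp only [RingHom.mapMatrix_apply, Matrix.map_apply, Matrix.submatrix_apply, hφM,
        Matrix.one_apply, hfinj.eq_iff]
      simp
    rw [this, Matrix.det_one]
  refine aux_upper (K := K) M φ {D 0 0, D 0 1, D 1 1} 3 Finset.card_le_three ?_ ?_
  · intro x hx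
    simp only [Finset.mem_insert, Finset.mem_singleton] at hx
    rcases hx with rfl | rfl | rfl
    · exact hD0 _ _ hf0
    · exact hD0 _ _ hf0
    · exact hD0 _ _ hf1
  · intro F _ ψ hψ hψφ
    let N := M.map ψ
    have hNd : (N.submatrix f f).det ≠ 0 := by
      intro h
      have h1 : ψ (M.submatrix f f).det = 0 := by
        rw [RingHom.map_det]; exact h
      have h2 := hψφ _ h1
      rw [hδ] at h2
      exact one_ne_zero h2
    have hND : ∀ r u, ψ (D r u) = 0 → (N.submatrix (Fin.cons r f : Fin (m+1) → Fin (m+2))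
        (Fin.cons u f : Fin (m+1) → Fin (m+2))).det = 0 := by
      intro r u h
      simp only [D] at h
      rw [RingHom.map_det] at h
      exact h
    have h00 := hND 0 0 (hψ _ (by simp))
    have h01 := hND 0 1 (hψ _ (by simp))
    have h11 := hND 1 1 (hψ _ (by simp))
    have h10 := hND 1 0 (by rw [hDs]; exact hψ _ (by simp))
    have hsol : ∀ u, ∃ z : Fin m → F, ∀ i, N (f i) u + ∑ j, N (f i) (f j) * z j = 0 := by
      intro u
      refine ⟨(N.submatrix f f)⁻¹.mulVec (fun i => - N (f i) u), fun i => ?_⟩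
      have h1 : (N.submatrix f f).mulVec ((N.submatrix f f)⁻¹.mulVec (fun i => - N (f i) u))
          = fun i => - N (f i) u := by
        rw [Matrix.mulVec_mulVec, Matrix.mul_nonsing_inv _ (isUnit_iff_ne_zero.mpr hNd),
          Matrix.one_mulVec]
      have h2 := congrFun h1 i
      change ∑ j, N (f i) (f j) * _ = _ at h2
      rw [h2]; ring
    obtain ⟨z0, hz0⟩ := hsol 0
    obtain ⟨z1, hz1⟩ := hsol 1
    have e00 := aux_border N f 0 0 hNd z0 hz0 h00
    have e10 := aux_border N f 1 0 hNd z0 hz0 h10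
    have e01 := aux_border N f 0 1 hNd z1 hz1 h01
    have e11 := aux_border N f 1 1 hNd z1 hz1 h11
    let v0 : Fin (m+2) → F := Fin.cons 1 (Fin.cons 0 z0 : Fin (m+1) → F)
    let v1 : Fin (m+2) → F := Fin.cons 0 (Fin.cons 1 z1 : Fin (m+1) → F)
    have hv0 : N.mulVec v0 = 0 := by
      funext i
      have hi : N i 0 + ∑ j, N i (f j) * z0 j = 0 := by
        refine Fin.cases e00 (fun i => ?_) i
        refine Fin.cases e10 (fun i => ?_) i
        exact hz0 i
      simpa [Matrix.mulVec, dotProduct, Fin.sum_univ_succ, v0, f] using hi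
    have hv1 : N.mulVec v1 = 0 := by
      funext i
      have hi : N i 1 + ∑ j, N i (f j) * z1 j = 0 := by
        refine Fin.cases e01 (fun i => ?_) i
        refine Fin.cases e11 (fun i => ?_) i
        exact hz1 i
      simpa [Matrix.mulVec, dotProduct, Fin.sum_univ_succ, v1, f] using hi
    intro c
    by_cases hc : v0 c = 0
    · refine ⟨v0, fun h => ?_, hv0, hc⟩
      have := congrFun h 0
      simp [v0] at this
    · refine ⟨v1 - (v1 c / v0 c) • v0, fun h => ?_, ?_, ?_⟩
      · have := congrFun h 1
        have a0 : v0 1 = 0 := rfl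
        have a1 : v1 1 = 1 := rfl
        simp [a0, a1] at this
      · change N.mulVec _ = 0
        rw [Matrix.mulVec_sub, Matrix.mulVec_smul, hv0, hv1]; simp
      · simp [hc]

end Aux

/-- The height of the ideal `I_{n-1}(X_G)` of submaximal minors of the sparse generic
symmetric matrix `X_G` is `3` if `G` is connected and `2` if `G` is disconnected. -/
theorem height_submaximalMinors_sparse_symmetric
    (K : Type*) [Field K] (n : ℕ) (hn : 2 ≤ n) (G : SimpleGraph (Fin n)) :
    (G.Connected → idealHeight (minorsIdeal (n - 1) (sparseGenericSym K n G)) = 3) ∧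
    (¬ G.Connected → idealHeight (minorsIdeal (n - 1) (sparseGenericSym K n G)) = 2) := by
  obtain ⟨m, rfl⟩ : ∃ m, n = m + 2 := ⟨n - 2, by omega⟩
  change (_ → idealHeight (minorsIdeal (m + 1) _) = 3) ∧
    (_ → idealHeight (minorsIdeal (m + 1) _) = 2)
  refine ⟨fun hG => le_antisymm (aux_upper_three G) ?_,
    fun hG => le_antisymm (aux_upper_two G hG) ?_⟩
  · exact le_iInf₂ fun p hp => (aux_lower G p hp).2 hG
  · exact le_iInf₂ fun p hp => (aux_lower G p hp).1
end

section
/- The minimal number of generators of the ideal I_{n-1}(X_G) ⊆ R (i.e., the smallest cardinality of a generating set, equivalently the span rank of I_{n-1}(X_G) as an R-module) equals binomial(n+1, 2) − D_G. -/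
open MvPolynomial
open scoped Classical

/-- The invariant `D_G = Σ_{s<t} |C_s|·|C_t|` of a graph `G`, where `C_1, …, C_r` are the
vertex sets of the connected components of `G`; equivalently, `D_G` is the number of
unordered pairs of vertices of `G` lying in two different connected components. -/
noncomputable def DG {n : ℕ} (G : SimpleGraph (Fin n)) : ℕ :=
  Nat.card {p : Fin n × Fin n // p.1 < p.2 ∧ ¬ G.Reachable p.1 p.2}

lemma aux_card_le {K σ ι : Type*} [Field K] [Fintype ι] (f : ι → MvPolynomial σ K) (d : ℕ)
    (hf : ∀ i, (f i).IsHomogeneous d) (li : LinearIndependent K f)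
    (S : Finset (MvPolynomial σ K))
    (h : Ideal.span (S : Set (MvPolynomial σ K)) = Ideal.span (Set.range f)) :
    Fintype.card ι ≤ S.card := by
  have hJ : Ideal.span (S : Set (MvPolynomial σ K)) ≤ idealOfVars σ K ^ d := by
    rw [h, Ideal.span_le]
    rintro _ ⟨i, rfl⟩
    rw [SetLike.mem_coe, mem_pow_idealOfVars_iff']
    intro x hx
    by_contra hne
    have := hf i hne
    have h2 : Finsupp.degree x = d := by
      rw [Finsupp.degree_eq_weight_one]; exact this
    omega
  have key : ∀ g ∈ Ideal.span (S : Set (MvPolynomial σ K)),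
      homogeneousComponent d g ∈
        Submodule.span K ((S.image (homogeneousComponent d) : Finset (MvPolynomial σ K)) :
          Set (MvPolynomial σ K)) := by
    intro g hg
    induction hg using Submodule.span_induction with
    | mem x hx =>
      apply Submodule.subset_span
      simp only [Finset.coe_image]
      exact ⟨x, hx, rfl⟩
    | zero => simp
    | add x y _ _ hx hy => rw [map_add]; exact Submodule.add_mem _ hx hy
    | smul a x hx ih =>
      have hxJ := (mem_pow_idealOfVars_iff' d x).1 (hJ hx)
      have : homogeneousComponent d (a • x) = (coeff 0 a) • homogeneousComponent d x := by
        ext m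
        rw [coeff_smul, coeff_homogeneousComponent, coeff_homogeneousComponent]
        split_ifs with hm
        · rw [smul_eq_mul, coeff_mul, smul_eq_mul]
          rw [Finset.sum_eq_single (0, m)]
          · rintro ⟨u, v⟩ huv hne
            rw [Finset.HasAntidiagonal.mem_antidiagonal] at huv
            simp only at huv ⊢
            rw [hxJ v, mul_zero]
            have h1 : u.degree + v.degree = d := by rw [← hm, ← huv, map_add]
            have h2 : u.degree ≠ 0 := by
              intro h0
              rw [Finsupp.degree_eq_zero_iff] at h0
              subst h0
              apply hne
              simp at huv
              rw [huv]
            omega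
          · intro hh
            simp at hh
        · simp
      rw [this]
      exact Submodule.smul_mem _ _ ih
  have h1 := linearIndependent_le_span_aux' f li
    ((S.image (homogeneousComponent d) : Finset (MvPolynomial σ K)) : Set (MvPolynomial σ K)) ?_
  · refine h1.trans ?_
    simp only [Fintype.card_coe, Finset.coe_sort_coe]
    exact Finset.card_image_le
  · rintro _ ⟨i, rfl⟩
    have := key (f i) (by rw [h]; exact Ideal.subset_span ⟨i, rfl⟩)
    rwa [homogeneousComponent_of_mem (hf i), if_pos rfl] at this

lemma aux_det_homog {K σ M : Type*} [Field K] [AddCommMonoid M] {n : ℕ} (w : σ → M)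
    (A : Matrix (Fin n) (Fin n) (MvPolynomial σ K)) (r c : Fin n → M)
    (h : ∀ a b, IsWeightedHomogeneous w (A a b) (r a + c b)) :
    IsWeightedHomogeneous w A.det (∑ a, r a + ∑ b, c b) := by
  rw [Matrix.det_apply]
  refine IsWeightedHomogeneous.sum _ _ _ fun τ _ => ?_
  have h1 : IsWeightedHomogeneous w (∏ i, A (τ i) i) (∑ a, r a + ∑ b, c b) := by
    have := IsWeightedHomogeneous.prod Finset.univ (fun i => A (τ i) i)
      (fun i => r (τ i) + c i) (w := w) (fun i _ => h _ _)
    rwa [Finset.sum_add_distrib, Equiv.sum_comp τ r] at this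
  rcases Int.units_eq_one_or (Equiv.Perm.sign τ) with h2 | h2 <;> rw [h2]
  · simpa using h1
  · rw [Units.neg_smul, one_smul]
    exact h1.neg

lemma aux_lin_indep {K σ M ι : Type*} [Field K] [AddCommMonoid M] [Fintype ι] (w : σ → M)
    (f : ι → MvPolynomial σ K) (d : ι → M) (hd : Function.Injective d)
    (hf : ∀ i, IsWeightedHomogeneous w (f i) (d i)) (h0 : ∀ i, f i ≠ 0) :
    LinearIndependent K f := by
  rw [Fintype.linearIndependent_iff]
  intro g hg i
  have := congrArg (weightedHomogeneousComponent w (d i)) hg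
  rw [map_sum, map_zero, Finset.sum_eq_single i] at this
  · rw [map_smul, (hf i).weightedHomogeneousComponent_same] at this
    exact (smul_eq_zero.1 this).resolve_right (h0 i)
  · intro j _ hj
    rw [map_smul, (hf j).weightedHomogeneousComponent_ne, smul_zero]
    exact fun h => hj (hd h.symm)
  · simp

section sparse
variable {K : Type*} [Field K] {n : ℕ} (G : SimpleGraph (Fin n))

lemma aux_X_transpose : (sparseGenericSym K n G).transpose = sparseGenericSym K n G := by
  ext i j : 2
  simp only [Matrix.transpose_apply, sparseGenericSym]
  rw [Sym2.eq_swap]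
  simp only [G.adj_comm j i, eq_comm (a := j) (b := i)]

lemma aux_adj_symm (i j : Fin n) : (sparseGenericSym K n G).adjugate i j =
    (sparseGenericSym K n G).adjugate j i := by
  have := Matrix.adjugate_transpose (sparseGenericSym K n G)
  rw [aux_X_transpose] at this
  exact congrFun (congrFun this j) i

lemma aux_X_eval : (eval (fun p : Sym2 (Fin n) => if p.IsDiag then (1 : K) else 0)).mapMatrix
    (sparseGenericSym K n G) = 1 := by
  ext i j : 2
  simp only [RingHom.mapMatrix_apply, Matrix.map_apply, sparseGenericSym, Matrix.one_apply]
  by_cases h : i = j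
  · simp [h]
  · by_cases h2 : G.Adj i j <;> simp [h, h2]

lemma aux_det_ne : (sparseGenericSym K n G).det ≠ 0 := by
  intro h
  have := RingHom.map_det (eval (fun p : Sym2 (Fin n) => if p.IsDiag then (1 : K) else 0))
    (sparseGenericSym K n G)
  rw [aux_X_eval, h] at this
  simp at this

lemma aux_adj_diag_ne (i : Fin n) : (sparseGenericSym K n G).adjugate i i ≠ 0 := by
  intro h
  have := RingHom.map_adjugate
    (eval (fun p : Sym2 (Fin n) => if p.IsDiag then (1 : K) else 0))
    (sparseGenericSym K n G)
  rw [aux_X_eval, Matrix.adjugate_one] at this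
  have h2 := congrFun (congrFun this i) i
  simp [RingHom.mapMatrix_apply, Matrix.map_apply, h] at h2

lemma aux_adj_zero {i j : Fin n} (h : ¬ G.Reachable i j) :
    (sparseGenericSym K n G).adjugate i j = 0 := by
  set A := sparseGenericSym K n G with hA
  let P : Matrix (Fin n) (Fin n) (SymPolyRing K n) :=
    Matrix.diagonal (fun k => if G.Reachable k j then 1 else 0)
  have hPA : P * A = A * P := by
    ext a b : 2
    simp only [P, Matrix.diagonal_mul, Matrix.mul_diagonal]
    have key : A a b ≠ 0 → (G.Reachable a j ↔ G.Reachable b j) := by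
      intro hne
      have hab : G.Reachable a b := by
        by_contra hab
        apply hne
        rw [hA, sparseGenericSym, if_neg]
        rintro (rfl | h)
        · exact hab (SimpleGraph.Reachable.refl _)
        · exact hab h.reachable
      exact ⟨fun h => hab.symm.trans h, fun h => hab.trans h⟩
    by_cases hz : A a b = 0
    · rw [hz]; simp
    · rw [mul_comm]; simp only [key hz]
  have h1 : A.det • (A.adjugate * P) = A.det • (P * A.adjugate) := by
    calc A.det • (A.adjugate * P) = A.adjugate * P * (A * A.adjugate) := by
          rw [Matrix.mul_adjugate, Matrix.mul_smul, Matrix.mul_one]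
      _ = A.adjugate * (P * A) * A.adjugate := by simp only [Matrix.mul_assoc]
      _ = (A.adjugate * A) * P * A.adjugate := by rw [hPA]; simp only [Matrix.mul_assoc]
      _ = _ := by rw [Matrix.adjugate_mul, Matrix.smul_mul, Matrix.smul_mul, Matrix.one_mul]
  have h2 := congrFun (congrFun h1 i) j
  simp only [P, Matrix.smul_apply, Matrix.diagonal_mul, Matrix.mul_diagonal, smul_eq_mul,
    if_neg h, if_pos (SimpleGraph.Reachable.refl j), mul_one, zero_mul, mul_zero] at h2
  exact (mul_eq_zero.1 h2).resolve_left (aux_det_ne G)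

lemma aux_adj_step {i j k : Fin n} (hjk : G.Adj j k)
    (h : (sparseGenericSym K n G).adjugate i j ≠ 0) :
    (sparseGenericSym K n G).adjugate i k ≠ 0 := by
  intro h0
  set A := sparseGenericSym K n G with hA
  let δ := pderiv (R := K) s(j, k)
  let E : Matrix (Fin n) (Fin n) (SymPolyRing K n) := A.map δ
  have hE : ∀ a b, E a b = if s(a, b) = s(j, k) then 1 else 0 := by
    intro a b
    simp only [E, Matrix.map_apply, hA, sparseGenericSym, δ]
    by_cases hab : s(a, b) = s(j, k)
    · have : G.Adj a b := by
        rw [← SimpleGraph.mem_edgeSet, hab]; exact hjk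
      simp [this, hab]
    · split_ifs
      · rw [pderiv_X_of_ne hab]
      · simp
  have h1 : A.adjugate.map δ * A + A.adjugate * E = (A.det • (1 : Matrix _ _ _)).map δ := by
    rw [← Matrix.adjugate_mul]
    ext a b : 2
    simp only [Matrix.add_apply, Matrix.mul_apply, Matrix.map_apply, map_sum, E,
      Derivation.leibniz, smul_eq_mul, Finset.sum_add_distrib]
    rw [add_comm]
    simp only [mul_comm]
  have h1' : (A.det • (1 : Matrix (Fin n) (Fin n) (SymPolyRing K n))).map δ = (δ A.det) • 1 := by
    ext a b : 2
    by_cases hab : a = b <;> simp [hab]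
  have h2 : A.det • (A.adjugate.map δ) + A.adjugate * E * A.adjugate = (δ A.det) • A.adjugate := by
    have := congrArg (· * A.adjugate) (h1.trans h1')
    simp only [Matrix.add_mul, Matrix.mul_assoc, Matrix.mul_adjugate, Matrix.mul_smul,
      Matrix.smul_mul, Matrix.mul_one, Matrix.one_mul] at this
    rw [Matrix.mul_assoc]
    exact this
  have h3 := congrFun (congrFun h2 i) k
  simp only [Matrix.add_apply, Matrix.smul_apply, Matrix.map_apply, h0, map_zero, smul_zero,
    zero_add] at h3
  have hne : j ≠ k := hjk.ne
  have h4 : ∀ b, (A.adjugate * E) i b = if b = k then A.adjugate i j else 0 := by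
    intro b
    rw [Matrix.mul_apply]
    simp only [hE, Sym2.eq_iff]
    split_ifs with hb
    · subst hb
      rw [Finset.sum_eq_single j]
      · simp
      · intro c _ hc
        rw [if_neg, mul_zero]
        rintro (h | h)
        · exact hc h.1
        · exact hne h.2.symm
      · simp
    · apply Finset.sum_eq_zero
      intro c _
      split_ifs with hc
      · rcases hc with hc | hc
        · exact absurd hc.2 hb
        · rw [hc.1, h0, zero_mul]
      · simp
  rw [Matrix.mul_apply] at h3
  simp only [h4, ite_mul, zero_mul, Finset.sum_ite_eq', Finset.mem_univ, if_true] at h3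
  exact (mul_ne_zero h (aux_adj_diag_ne G k)) h3

lemma aux_adj_ne {i j : Fin n} (h : G.Reachable i j) :
    (sparseGenericSym K n G).adjugate i j ≠ 0 := by
  rw [SimpleGraph.reachable_iff_reflTransGen] at h
  induction h with
  | refl => exact aux_adj_diag_ne G i
  | tail _ h ih => exact aux_adj_step G h ih

lemma aux_adj_homog (i j : Fin n) :
    ((sparseGenericSym K n G).adjugate i j).IsHomogeneous (n - 1) := by
  rw [Matrix.adjugate_apply]
  have := aux_det_homog (1 : Sym2 (Fin n) → ℕ)
    ((sparseGenericSym K n G).updateRow j (Pi.single i 1))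
    (fun a => if a = j then 0 else 1) (fun _ => 0) ?_
  · have h2 : (∑ a : Fin n, (if a = j then 0 else 1) + ∑ _b : Fin n, 0) = n - 1 := by
      simp [Finset.sum_ite, Finset.filter_ne']
    rwa [h2] at this
  · intro a b
    by_cases ha : a = j
    · subst ha
      rw [Matrix.updateRow_self]
      by_cases hb : b = i
      · subst hb
        simpa using isWeightedHomogeneous_one K _
      · simpa [hb] using isWeightedHomogeneous_zero K _ _
    · rw [Matrix.updateRow_ne ha]
      simp only [sparseGenericSym, ha, if_false, add_zero]
      split_ifs
      · exact isWeightedHomogeneous_X K _ _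
      · exact isWeightedHomogeneous_zero K _ _

/-- weight of a variable. -/
noncomputable def auxW (n : ℕ) : Sym2 (Fin n) → (Fin n → ℤ) :=
  Sym2.lift ⟨fun a b => Pi.single a 1 + Pi.single b 1, fun _ _ => add_comm _ _⟩

lemma aux_adj_weight (i j : Fin n) :
    IsWeightedHomogeneous (auxW n) ((sparseGenericSym K n G).adjugate i j)
      ((fun _ => 2) - auxW n s(i, j)) := by
  rw [Matrix.adjugate_apply]
  have := aux_det_homog (auxW n)
    ((sparseGenericSym K n G).updateRow j (Pi.single i 1))
    (fun a => Pi.single a 1 - if a = j then auxW n s(i, j) else 0) (fun b => Pi.single b 1) ?_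
  · convert this using 1
    have h1 : ∑ b : Fin n, (Pi.single b 1 : Fin n → ℤ) = 1 := by
      ext x; simp [Finset.sum_apply, Pi.single_apply]
    rw [Finset.sum_sub_distrib, h1]
    simp only [Finset.sum_ite_eq', Finset.mem_univ, if_true]
    ext x
    simp
    ring
  · intro a b
    by_cases ha : a = j
    · subst ha
      rw [Matrix.updateRow_self]
      by_cases hb : b = i
      · subst hb
        simp only [if_true, Pi.single_eq_same]
        convert isWeightedHomogeneous_one K (auxW n) using 1
        simp [auxW]
      · rw [Pi.single_eq_of_ne hb]
        exact isWeightedHomogeneous_zero K _ _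
    · rw [Matrix.updateRow_ne ha]
      simp only [sparseGenericSym, ha, if_false, sub_zero]
      split_ifs
      · exact isWeightedHomogeneous_X K _ _
      · exact isWeightedHomogeneous_zero K _ _

lemma auxW_inj : Function.Injective (auxW n) := by
  intro p q
  induction p using Sym2.ind with | _ a b =>
  induction q using Sym2.ind with | _ c d =>
  intro h
  simp only [auxW, Sym2.lift_mk] at h
  have ha := congrFun h a
  have hb := congrFun h b
  have hc := congrFun h c
  simp only [Pi.add_apply, Pi.single_apply] at ha hb hc
  rw [Sym2.eq_iff]
  by_cases h1 : a = c <;> by_cases h2 : a = d <;> by_cases h3 : b = c <;> by_cases h4 : b = d <;>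
    by_cases h5 : a = b <;> by_cases h6 : c = d <;>
    simp_all
end sparse

lemma aux_factor {m : ℕ} (f : Fin m → Fin (m + 1)) (hf : Function.Injective f) :
    ∃ (j : Fin (m + 1)) (τ : Equiv.Perm (Fin m)), f = j.succAbove ∘ τ := by
  have hns : ¬ Function.Surjective f := by
    intro hs
    have := Fintype.card_le_of_surjective f hs
    simp at this
  simp only [Function.Surjective, not_forall, not_exists] at hns
  obtain ⟨j, hj⟩ := hns
  have hex : ∀ x, ∃ y, j.succAbove y = f x := fun x => Fin.exists_succAbove_eq (hj x)
  choose g hg using hex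
  have hginj : Function.Injective g := by
    intro x y hxy
    apply hf
    rw [← hg, ← hg, hxy]
  exact ⟨j, Equiv.ofBijective g (Finite.injective_iff_bijective.1 hginj), by
    ext x; simp [hg]⟩

lemma aux_minors {R : Type*} [CommRing R] {m : ℕ} (A : Matrix (Fin (m + 1)) (Fin (m + 1)) R) :
    minorsIdeal m A = Ideal.span (Set.range fun p : Fin (m + 1) × Fin (m + 1) =>
      A.adjugate p.1 p.2) := by
  apply le_antisymm
  · rw [minorsIdeal, Ideal.span_le]
    rintro _ ⟨f, g, hf, hg, rfl⟩
    obtain ⟨i, σ, rfl⟩ := aux_factor f hf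
    obtain ⟨j, τ, rfl⟩ := aux_factor g hg
    have h1 : A.submatrix (i.succAbove ∘ σ) (j.succAbove ∘ τ) =
      ((A.submatrix i.succAbove j.succAbove).submatrix σ id).submatrix id τ := rfl
    rw [h1, Matrix.det_permute', Matrix.det_permute]
    have h2 := Matrix.adjugate_fin_succ_eq_det_submatrix A j i
    have h3 : (A.submatrix i.succAbove j.succAbove).det =
        (-1) ^ (i + j : ℕ) * A.adjugate j i := by
      rw [h2, ← mul_assoc, ← mul_pow]; simp
    rw [h3]
    refine Ideal.mul_mem_left _ _ (Ideal.mul_mem_left _ _ (Ideal.mul_mem_left _ _ ?_))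
    exact Ideal.subset_span ⟨(j, i), rfl⟩
  · rw [Ideal.span_le]
    rintro _ ⟨⟨i, j⟩, rfl⟩
    simp only
    rw [Matrix.adjugate_fin_succ_eq_det_submatrix]
    refine Ideal.mul_mem_left _ _ (Ideal.subset_span ?_)
    exact ⟨_, _, Fin.succAbove_right_injective, Fin.succAbove_right_injective, rfl⟩

lemma aux_count {n : ℕ} (G : SimpleGraph (Fin n)) :
    Fintype.card {p : Fin n × Fin n // p.1 ≤ p.2 ∧ G.Reachable p.1 p.2} =
      Nat.choose (n + 1) 2 - DG G := by
  have h1 : Fintype.card {p : Fin n × Fin n // p.1 ≤ p.2} = Nat.choose (n + 1) 2 := by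
    rw [← Fintype.card_congr (Sym2.sortEquiv (α := Fin n)), Sym2.card, Fintype.card_fin]
  rw [DG, Nat.card_eq_fintype_card, ← h1]
  simp only [Fintype.card_subtype]
  rw [← Finset.card_filter_add_card_filter_not (s := {p : Fin n × Fin n | p.1 ≤ p.2})
    (fun p => G.Reachable p.1 p.2), Finset.filter_filter, Finset.filter_filter]
  have : ({p : Fin n × Fin n | p.1 ≤ p.2 ∧ ¬ G.Reachable p.1 p.2} : Finset _) =
      ({p : Fin n × Fin n | p.1 < p.2 ∧ ¬ G.Reachable p.1 p.2} : Finset _) := by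
    ext p
    simp only [Finset.mem_filter, Finset.mem_univ, true_and]
    constructor
    · rintro ⟨h, h'⟩
      refine ⟨lt_of_le_of_ne h ?_, h'⟩
      intro he
      rw [he] at h'
      exact h' (SimpleGraph.Reachable.refl _)
    · rintro ⟨h, h'⟩
      exact ⟨h.le, h'⟩
  rw [this]
  omega

/-- The minimal number of generators of the ideal `I_{n-1}(X_G)` of submaximal minors of
the sparse generic symmetric matrix `X_G`, i.e. the smallest cardinality of a generating
set, equals `C(n+1,2) - D_G`. -/
theorem minimalGenerators_submaximalMinors_sparse_symmetric
    (K : Type*) [Field K] (n : ℕ) (hn : 2 ≤ n) (G : SimpleGraph (Fin n)) :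
    IsLeast {k : ℕ | ∃ S : Finset (SymPolyRing K n), S.card = k ∧
        Ideal.span (S : Set (SymPolyRing K n)) = minorsIdeal (n - 1) (sparseGenericSym K n G)}
      (Nat.choose (n + 1) 2 - DG G) := by
  obtain ⟨m, rfl⟩ : ∃ m, n = m + 1 := ⟨n - 1, by omega⟩
  rw [← aux_count G]
  let ι := {p : Fin (m + 1) × Fin (m + 1) // p.1 ≤ p.2 ∧ G.Reachable p.1 p.2}
  let f : ι → SymPolyRing K (m + 1) :=
    fun p => (sparseGenericSym K (m + 1) G).adjugate p.1.1 p.1.2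
  have li : LinearIndependent K f := by
    refine aux_lin_indep (auxW (m + 1)) f
      (fun p => (fun _ => 2) - auxW (m + 1) s(p.1.1, p.1.2)) ?_
      (fun p => aux_adj_weight G _ _) (fun p => aux_adj_ne G p.2.2)
    rintro ⟨⟨a, b⟩, hab, _⟩ ⟨⟨c, d⟩, hcd, _⟩ h
    have h' := auxW_inj (sub_right_injective h)
    simp only [Sym2.eq_iff] at h'
    simp only at hab hcd
    rcases h' with ⟨rfl, rfl⟩ | ⟨rfl, rfl⟩
    · rfl
    · have := le_antisymm hab hcd
      subst this
      rfl
  have hI : minorsIdeal (m + 1 - 1) (sparseGenericSym K (m + 1) G) =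
      Ideal.span (Set.range f) := by
    rw [Nat.add_sub_cancel, aux_minors]
    apply le_antisymm
    · rw [Ideal.span_le]
      rintro _ ⟨⟨i, j⟩, rfl⟩
      by_cases h : G.Reachable i j
      · rcases le_total i j with hij | hij
        · exact Ideal.subset_span ⟨⟨(i, j), hij, h⟩, rfl⟩
        · exact Ideal.subset_span ⟨⟨(j, i), hij, h.symm⟩, aux_adj_symm G j i⟩
      · simp only [aux_adj_zero G h]
        exact Ideal.zero_mem _
    · apply Ideal.span_mono
      rintro _ ⟨p, rfl⟩
      exact ⟨p.1, rfl⟩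
  constructor
  · refine ⟨Finset.univ.image f, ?_, ?_⟩
    · rw [Finset.card_image_of_injective _ li.injective, Finset.card_univ]
    · rw [hI]; simp
  · rintro k ⟨S, rfl, hS⟩
    exact aux_card_le f (m + 1 - 1) (fun p => aux_adj_homog G _ _) li S (hS.trans hI)
end
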